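/- arXiv:math/0507369 — 2 statements merged into one kernel-verified Lean document; each statement's English description precedes it below -/
import Mathlib

section
/- Let k = m + l with m ≥ 1, l ≥ 0 integers. Let (R_α)_{α∈J} be a countable family of l-dimensional affine planes in ℝ^k and Υ : J → ℝ⁺ a function such that {α : Υ_α > ε} is finite for each ε > 0. Let V be an m-dimensional linear subspace of ℝ^k with (i) V ∩ R_α ≠ ∅ for all α and (ii) sup_α diam(V ∩ Δ(R_α,1)) < ∞. Let f be a dimension function with r^{-k} f(r) monotonic, such that g(r) := r^{-l} f(r) is also a dimension function, and let Ω be a ball in ℝ^k. If for every ball B in Ω, H^k(B ∩ Λ(g(Υ)^{1/m})) = H^k(B), then for every ball B in Ω, H^f(B ∩ Λ(Υ)) = H^f(B). -/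
open MeasureTheory Set Filter
open scoped ENNReal

def IsDimFun (f : ℝ → ℝ) : Prop :=
  ContinuousOn f (Set.Ici 0) ∧ MonotoneOn f (Set.Ici 0) ∧
    (∀ r, 0 ≤ r → 0 ≤ f r) ∧ Filter.Tendsto f (nhdsWithin 0 (Set.Ioi 0)) (nhds 0)

noncomputable def hMeasure {X : Type*} [EMetricSpace X] [MeasurableSpace X] [BorelSpace X]
    (f : ℝ → ℝ) : Measure X :=
  Measure.mkMetric (fun d => ENNReal.ofReal (f d.toReal))

/-- The limsup set `Λ(Υ)`: points lying in the `Υ_α`-neighborhood `Δ(R_α, Υ_α)`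
of the plane `R_α` for infinitely many `α ∈ J`. -/
def Lam {k : ℕ} {J : Type*} (R : J → AffineSubspace ℝ (EuclideanSpace ℝ (Fin k)))
    (U : J → ℝ) : Set (EuclideanSpace ℝ (Fin k)) :=
  {x | {α | 0 < U α ∧ Metric.infDist x (R α : Set (EuclideanSpace ℝ (Fin k))) < U α}.Infinite}

/-- volume of a box in an orthonormal coordinate system -/
lemma vol_box {k : ℕ} {ι : Type*} [Fintype ι]
    (b : OrthonormalBasis ι ℝ (EuclideanSpace ℝ (Fin k))) (a c : ι → ℝ) :
    volume {w : EuclideanSpace ℝ (Fin k) | ∀ j, b.repr w j ∈ Icc (a j) (c j)} =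
      ∏ j, ENNReal.ofReal (c j - a j) := by
  have h1 := (PiLp.volume_preserving_ofLp ι).comp b.measurePreserving_repr
  have h2 : {w : EuclideanSpace ℝ (Fin k) | ∀ j, b.repr w j ∈ Icc (a j) (c j)} =
      ((@WithLp.ofLp 2 (ι → ℝ)) ∘ b.repr) ⁻¹' (Set.pi univ fun j => Icc (a j) (c j)) := by
    ext w
    exact ⟨fun h j _ => h j, fun h j => h j trivial⟩
  rw [h2, h1.measure_preimage, volume_pi_pi]
  · simp
  · exact (MeasurableSet.univ_pi fun j => measurableSet_Icc).nullMeasurableSet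

lemma repr_sub_le {k : ℕ} {ι : Type*} [Fintype ι]
    (b : OrthonormalBasis ι ℝ (EuclideanSpace ℝ (Fin k))) (x y : EuclideanSpace ℝ (Fin k)) (j : ι) :
    |b.repr x j - b.repr y j| ≤ dist x y := by
  have h : b.repr x j - b.repr y j = inner ℝ (b j) (x - y) := by
    rw [inner_sub_right, b.repr_apply_apply, b.repr_apply_apply]
  rw [h, dist_eq_norm]
  refine (abs_real_inner_le_norm _ _).trans ?_
  rw [b.norm_eq_one, one_mul]

lemma norm_sum_basis_le {k : ℕ} {ι κ : Type*} [Fintype ι] [Fintype κ]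
    (b : OrthonormalBasis ι ℝ (EuclideanSpace ℝ (Fin k))) (e : κ → ι) (c : κ → ℝ) (M : ℝ)
    (h : ∀ j, |c j| ≤ M) : ‖∑ j, c j • b (e j)‖ ≤ Fintype.card κ * M := by
  refine (norm_sum_le _ _).trans ?_
  calc _ ≤ ∑ j : κ, M := by
        refine Finset.sum_le_sum fun j _ => ?_
        rw [norm_smul, b.norm_eq_one, mul_one]; exact h j
    _ = _ := by simp

/-- The tube around an affine plane. -/
lemma exists_tube {k l m : ℕ} (hm : 0 < m) (hk : k = m + l)
    (S : AffineSubspace ℝ (EuclideanSpace ℝ (Fin k)))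
    (hdim : Module.finrank ℝ S.direction = l) (y : EuclideanSpace ℝ (Fin k)) (hy : y ∈ S)
    (r u : ℝ) (hr : 0 < r) (hu : 0 < u) (hur : u ≤ r) :
    ∃ T : Set (EuclideanSpace ℝ (Fin k)), IsCompact T ∧ T ⊆ Metric.closedBall y r ∧
      (∀ w ∈ T, Metric.infDist w (S : Set (EuclideanSpace ℝ (Fin k))) < u) ∧
      volume T = ENNReal.ofReal ((2 * r / k) ^ l * (u / k) ^ m) ∧
      (∀ (A : Set (EuclideanSpace ℝ (Fin k))) (s : ℝ), 0 ≤ s →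
        (∀ a ∈ A, ∀ a' ∈ A, dist a a' ≤ s) →
        volume (T ∩ A) ≤ ENNReal.ofReal ((2 * s) ^ k) ∧
        volume (T ∩ A) ≤ ENNReal.ofReal ((2 * s) ^ l * (u / k) ^ m)) := by
  classical
  have hk0 : 0 < (k : ℝ) := by rw [hk]; exact_mod_cast Nat.add_pos_left hm l
  have hkml : (k : ℝ) = m + l := by rw [hk]; push_cast; ring
  -- adapted orthonormal basis
  obtain ⟨b, hb⟩ : ∃ b : OrthonormalBasis (Fin l ⊕ Fin m) ℝ (EuclideanSpace ℝ (Fin k)),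
      ∀ j : Fin l, b (Sum.inl j) ∈ S.direction := by
    let e := (stdOrthonormalBasis ℝ S.direction).reindex (finCongr hdim)
    let v : Fin l ⊕ Fin m → EuclideanSpace ℝ (Fin k) :=
      fun i => Sum.elim (fun j => (e j : EuclideanSpace ℝ (Fin k))) (fun _ => 0) i
    have hv : Orthonormal ℝ ((range (Sum.inl : Fin l → Fin l ⊕ Fin m)).domRestrict v) := by
      have he : Orthonormal ℝ (fun j => (e j : EuclideanSpace ℝ (Fin k))) := by
        have := e.orthonormal.comp_linearIsometry S.direction.subtypeₗᵢ
        exact this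
      rw [orthonormal_iff_ite] at he ⊢
      rintro ⟨_, i, rfl⟩ ⟨_, j, rfl⟩
      refine (he i j).trans ?_
      by_cases hij : i = j
      · subst hij; rw [if_pos rfl, if_pos rfl]
      · rw [if_neg hij, if_neg]
        intro h
        exact hij (Sum.inl_injective (congrArg Subtype.val h))
    obtain ⟨b, hb⟩ := hv.exists_orthonormalBasis_extension_of_card_eq (by simp [hk, add_comm])
    refine ⟨b, fun j => ?_⟩
    rw [hb _ ⟨j, rfl⟩]
    exact (e j).2
  let hw : Fin l ⊕ Fin m → ℝ := Sum.elim (fun _ => r / k) (fun _ => u / (2 * k))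
  let T : Set (EuclideanSpace ℝ (Fin k)) :=
    {w | ∀ j, b.repr w j ∈ Icc (b.repr y j - hw j) (b.repr y j + hw j)}
  have hTabs : ∀ w ∈ T, ∀ j, |b.repr w j - b.repr y j| ≤ hw j := by
    intro w hw' j
    have := hw' j
    rw [abs_le]; constructor <;> linarith [this.1, this.2]
  have hexp : ∀ w, w - y = (∑ j : Fin l, (b.repr w (Sum.inl j) - b.repr y (Sum.inl j)) • b (Sum.inl j))
      + ∑ j : Fin m, (b.repr w (Sum.inr j) - b.repr y (Sum.inr j)) • b (Sum.inr j) := by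
    intro w
    have := (b.sum_repr (w - y)).symm
    rw [Fintype.sum_sum_type] at this
    simpa using this
  have hT1 : T ⊆ Metric.closedBall y r := by
    intro w hw'
    rw [Metric.mem_closedBall, dist_eq_norm, hexp w]
    have h1 := norm_sum_basis_le b Sum.inl
      (fun j => b.repr w (Sum.inl j) - b.repr y (Sum.inl j)) (r / k) (fun j => hTabs w hw' (Sum.inl j))
    have h2 := norm_sum_basis_le b Sum.inr
      (fun j => b.repr w (Sum.inr j) - b.repr y (Sum.inr j)) (u / (2 * k)) (fun j => hTabs w hw' (Sum.inr j))
    refine (norm_add_le _ _).trans ((add_le_add h1 h2).trans ?_)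
    have h3 : u / (2 * k) ≤ r / k := by
      rw [div_le_div_iff₀ (by positivity) hk0]
      nlinarith
    simp only [Fintype.card_fin]
    calc (l : ℝ) * (r / k) + m * (u / (2 * k)) ≤ l * (r / k) + m * (r / k) := by gcongr
      _ = (m + l) * (r / k) := by ring
      _ = r := by rw [← hkml]; field_simp
  refine ⟨T, ?_, hT1, ?_, ?_, ?_⟩
  · refine Metric.isCompact_of_isClosed_isBounded ?_ (Metric.isBounded_closedBall.subset hT1)
    have : T = ⋂ j, (fun w => b.repr w j) ⁻¹' Icc (b.repr y j - hw j) (b.repr y j + hw j) := by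
      ext w; simp [T]
    rw [this]
    refine isClosed_iInter fun j => isClosed_Icc.preimage ?_
    fun_prop
  · intro w hw'
    set p := y + ∑ j : Fin l, (b.repr w (Sum.inl j) - b.repr y (Sum.inl j)) • b (Sum.inl j) with hp
    have hpS : p ∈ S := by
      have : (∑ j : Fin l, (b.repr w (Sum.inl j) - b.repr y (Sum.inl j)) • b (Sum.inl j)) ∈ S.direction :=
        Submodule.sum_mem _ fun j _ => Submodule.smul_mem _ _ (hb j)
      have := AffineSubspace.vadd_mem_of_mem_direction this hy
      rwa [vadd_eq_add, add_comm] at this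
    refine (Metric.infDist_le_dist_of_mem (x := w) (show p ∈ (S : Set _) from hpS)).trans_lt ?_
    have h2 := norm_sum_basis_le b Sum.inr
      (fun j => b.repr w (Sum.inr j) - b.repr y (Sum.inr j)) (u / (2 * k)) (fun j => hTabs w hw' (Sum.inr j))
    rw [dist_eq_norm]
    have : w - p = ∑ j : Fin m, (b.repr w (Sum.inr j) - b.repr y (Sum.inr j)) • b (Sum.inr j) := by
      rw [hp, ← sub_sub, hexp w]; abel
    rw [this]
    refine h2.trans_lt ?_
    rw [Fintype.card_fin]
    have : (m : ℝ) ≤ k := by rw [hkml]; simp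
    calc (m : ℝ) * (u / (2 * k)) ≤ k * (u / (2 * k)) := by gcongr
      _ = u / 2 := by field_simp
      _ < u := by linarith
  · rw [vol_box, Fintype.prod_sum_type]
    simp only [hw, Sum.elim_inl, Sum.elim_inr, add_sub_sub_cancel]
    rw [Finset.prod_const, Finset.prod_const, Finset.card_univ, Finset.card_univ, Fintype.card_fin,
      Fintype.card_fin, ← ENNReal.ofReal_pow (by positivity), ← ENNReal.ofReal_pow (by positivity),
      ← ENNReal.ofReal_mul (by positivity)]
    congr 2
    · congr 1; ring
    · congr 1; field_simp; ring
  · intro A s hs hA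
    rcases A.eq_empty_or_nonempty with rfl | ⟨a, ha⟩
    · simp
    constructor
    · calc volume (T ∩ A) ≤ volume {w : EuclideanSpace ℝ (Fin k) |
            ∀ j, b.repr w j ∈ Icc (b.repr a j - s) (b.repr a j + s)} := by
            refine measure_mono ?_
            rintro w ⟨-, hwA⟩ j
            have := (repr_sub_le b w a j).trans (hA _ hwA _ ha)
            rw [abs_le] at this
            constructor <;> linarith [this.1, this.2]
        _ = _ := by
            rw [vol_box]
            simp only [add_sub_sub_cancel]
            rw [Finset.prod_const, Finset.card_univ, ENNReal.ofReal_pow (by positivity)]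
            simp only [Fintype.card_sum, Fintype.card_fin]
            rw [hk, add_comm l m, two_mul]
    · calc volume (T ∩ A) ≤ volume {w : EuclideanSpace ℝ (Fin k) |
            ∀ j, b.repr w j ∈ Icc ((Sum.elim (fun i => b.repr a (Sum.inl i) - s)
              (fun i => b.repr y (Sum.inr i) - u / (2 * k)) : Fin l ⊕ Fin m → ℝ) j)
             ((Sum.elim (fun i => b.repr a (Sum.inl i) + s)
              (fun i => b.repr y (Sum.inr i) + u / (2 * k)) : Fin l ⊕ Fin m → ℝ) j)} := by
            refine measure_mono ?_
            rintro w ⟨hwT, hwA⟩ (j | j)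
            · have := (repr_sub_le b w a (Sum.inl j)).trans (hA _ hwA _ ha)
              rw [abs_le] at this
              constructor <;> simp only [Sum.elim_inl] <;> linarith [this.1, this.2]
            · exact hwT (Sum.inr j)
        _ = _ := by
            rw [vol_box, Fintype.prod_sum_type]
            simp only [Sum.elim_inl, Sum.elim_inr, add_sub_sub_cancel]
            rw [Finset.prod_const, Finset.prod_const, Finset.card_univ, Finset.card_univ, Fintype.card_fin,
              Fintype.card_fin, ← ENNReal.ofReal_pow (by positivity), ← ENNReal.ofReal_pow (by positivity),
              ← ENNReal.ofReal_mul (by positivity)]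
            congr 2
            · congr 1; ring
            · congr 1; field_simp; ring

lemma exists_omega (k : ℕ) : ∃ ω : ℝ, 0 < ω ∧ ∀ (x : EuclideanSpace ℝ (Fin k)) (ρ : ℝ), 0 ≤ ρ →
    volume (Metric.closedBall x ρ) = ENNReal.ofReal (ρ ^ k * ω) := by
  refine ⟨(volume (Metric.ball (0 : EuclideanSpace ℝ (Fin k)) 1)).toReal, ?_, ?_⟩
  · exact ENNReal.toReal_pos (Metric.measure_ball_pos _ _ one_pos).ne' measure_ball_lt_top.ne
  · intro x ρ hρ
    rw [Measure.addHaar_closedBall _ _ hρ, ENNReal.ofReal_mul (by positivity),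
      ENNReal.ofReal_toReal measure_ball_lt_top.ne]
    simp

lemma local_measure {k l m : ℕ} (hm : 0 < m) (hk : k = m + l) {J : Type*}
    (R : J → AffineSubspace ℝ (EuclideanSpace ℝ (Fin k)))
    (hRne : ∀ α, (R α : Set (EuclideanSpace ℝ (Fin k))).Nonempty)
    (hRdim : ∀ α, Module.finrank ℝ (R α).direction = l)
    (Υ : J → ℝ) (f g : ℝ → ℝ) (hf0 : ∀ r, 0 ≤ r → 0 ≤ f r)
    (hgmono : MonotoneOn g (Set.Ici 0))
    (hanti : AntitoneOn (fun r => f r / r ^ k) (Set.Ioi 0))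
    (hgdef : ∀ r > (0:ℝ), g r = f r / r ^ l)
    (D : ℝ) (hD : 0 < D) (r : J → ℝ) (hr : ∀ α, 0 < r α → 0 < Υ α ∧ r α ^ m * D = g (Υ α))
    (hrfin : ∀ ε > (0:ℝ), {α | r α > ε}.Finite)
    (G : Set J) (hG : Gᶜ.Finite) (hGr : ∀ α ∈ G, 0 < r α → Υ α ≤ r α)
    (c : EuclideanSpace ℝ (Fin k)) (s0 : ℝ) (hs0 : 0 < s0)
    (hae : ∀ᵐ x, x ∈ Metric.ball c (s0 / 4) →
      {α | 0 < r α ∧ Metric.infDist x (R α : Set (EuclideanSpace ℝ (Fin k))) < r α}.Infinite)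
    (hfs : ∀ s, 0 < s → s ≤ s0 → (6 * k : ℝ) ^ k * D * s ^ k ≤ f s) :
    ∃ (ν : Measure (EuclideanSpace ℝ (Fin k))) (K : Set (EuclideanSpace ℝ (Fin k))) (D' : ℝ≥0∞),
      IsCompact K ∧ K ⊆ Metric.ball c (s0 / 2) ∧
      (∀ x ∈ K, ∃ α ∈ G, 0 < Υ α ∧
        Metric.infDist x (R α : Set (EuclideanSpace ℝ (Fin k))) < Υ α) ∧
      ν Kᶜ = 0 ∧ D' ≠ ∞ ∧ (∀ A, ν A ≤ D' * volume A) ∧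
      ENNReal.ofReal (((2 * k : ℝ) ^ k * k ^ k * 60 ^ k * 2)⁻¹ * D * s0 ^ k) ≤ ν univ ∧
      ∀ (s : ℝ) (A : Set (EuclideanSpace ℝ (Fin k))), 0 < s → s ≤ s0 →
        (∀ a ∈ A, ∀ a' ∈ A, dist a a' ≤ k * s) → ν A ≤ ENNReal.ofReal (f s) := by
  classical
  have hk1 : (1 : ℝ) ≤ k := by rw [hk]; exact_mod_cast (show 1 ≤ m + l by omega)
  have hk0 : (0 : ℝ) < k := by linarith
  obtain ⟨ω, hω, hball⟩ := exists_omega k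
  let t : Set (EuclideanSpace ℝ (Fin k) × J) := {p | p.1 ∈ Metric.ball c (s0 / 4) ∧ p.2 ∈ G ∧
    0 < r p.2 ∧ r p.2 ≤ s0 / 12 ∧ Metric.infDist p.1 (R p.2 : Set (EuclideanSpace ℝ (Fin k))) < r p.2}
  obtain ⟨u, hut, hdisj, hcov⟩ := Vitali.exists_disjoint_subfamily_covering_enlargement_closedBall
    t Prod.fst (fun p => 3 * r p.2) (s0 / 4) (fun p hp => by linarith [hp.2.2.2.1]) 5 (by norm_num)
  have hucount : u.Countable := by
    refine hdisj.countable_of_nonempty_interior fun p hp => ?_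
    refine ⟨p.1, mem_interior_iff_mem_nhds.2 (Metric.closedBall_mem_nhds _ ?_)⟩
    linarith [(hut hp).2.2.1]
  have hcount : Countable u := hucount.to_subtype
  have hV : volume (Metric.ball c (s0 / 4)) ≤
      ∑' p : u, volume (Metric.closedBall p.1.1 (5 * (3 * r p.1.2))) := by
    refine le_trans (measure_mono_ae (t := ⋃ p : u, Metric.closedBall p.1.1 (5 * (3 * r p.1.2))) ?_)
      (measure_iUnion_le _)
    filter_upwards [hae] with x hx hxb
    have hinf := ((hx hxb).sdiff hG).sdiff (hrfin (s0 / 12) (by positivity))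
    obtain ⟨α, ⟨⟨h1, h2⟩, h3⟩, h4⟩ := hinf.nonempty
    have h5 : (x, α) ∈ t := ⟨hxb, by simpa using h3, h1, by simpa using h4, h2⟩
    obtain ⟨p, hp, hsub⟩ := hcov _ h5
    have hxx := hsub (Metric.mem_closedBall_self (by simp only; linarith))
    exact mem_iUnion.2 ⟨⟨p, hp⟩, hxx⟩
  have hVval : volume (Metric.ball c (s0 / 4)) = ENNReal.ofReal ((s0 / 4) ^ k * ω) := by
    have : Nonempty (Fin k) := ⟨⟨0, by omega⟩⟩
    rw [← Measure.addHaar_closedBall_eq_addHaar_ball, hball _ _ (by positivity)]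
  obtain ⟨I, hI⟩ : ∃ I : Finset u, (s0 / 4) ^ k / 2 ≤ ∑ i ∈ I, (15 * r i.1.2) ^ k := by
    have h1 : ENNReal.ofReal ((s0 / 4) ^ k / 2 * ω) <
        ∑' p : u, volume (Metric.closedBall p.1.1 (5 * (3 * r p.1.2))) := by
      refine lt_of_lt_of_le ?_ hV
      rw [hVval]
      have : 0 < (s0 / 4) ^ k := by positivity
      refine (ENNReal.ofReal_lt_ofReal_iff (by positivity)).2 ?_
      nlinarith
    rw [ENNReal.tsum_eq_iSup_sum, lt_iSup_iff] at h1
    obtain ⟨I, hI⟩ := h1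
    refine ⟨I, ?_⟩
    have h2 : ∀ i ∈ I, volume (Metric.closedBall i.1.1 (5 * (3 * r i.1.2))) =
        ENNReal.ofReal ((15 * r i.1.2) ^ k * ω) := by
      intro i _
      have := (hut i.2).2.2.1
      rw [hball _ _ (by positivity)]
      congr 3; ring
    rw [Finset.sum_congr rfl h2, ← ENNReal.ofReal_sum_of_nonneg, ← Finset.sum_mul] at hI
    · have h3 := (ENNReal.ofReal_lt_ofReal_iff').1 hI
      exact (lt_of_mul_lt_mul_right h3.1 hω.le).le
    · intro i _
      have := (hut i.2).2.2.1
      positivity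
  have hy : ∀ i : u, ∃ y ∈ R i.1.2, dist i.1.1 y < r i.1.2 := fun i =>
    (Metric.infDist_lt_iff (hRne _)).1 (hut i.2).2.2.2.2
  choose y hyR hyd using hy
  have hrpos : ∀ i : u, 0 < r i.1.2 := fun i => (hut i.2).2.2.1
  have hUpos : ∀ i : u, 0 < Υ i.1.2 := fun i => (hr _ (hrpos i)).1
  have hT := fun i : u => exists_tube hm hk (R i.1.2) (hRdim _) (y i) (hyR i) (r i.1.2) (Υ i.1.2)
    (hrpos i) (hUpos i) (hGr _ (hut i.2).2.1 (hrpos i))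
  choose T hTc hTb hTd hTv hTA using hT
  have hTm : ∀ i, MeasurableSet (T i) := fun i => (hTc i).measurableSet
  have hTx : ∀ i, T i ⊆ Metric.closedBall i.1.1 (2 * r i.1.2) := by
    intro i w hw
    have h1 := hTb i hw
    rw [Metric.mem_closedBall] at h1 ⊢
    have := dist_triangle w (y i) i.1.1
    have h2 := hyd i
    rw [dist_comm] at h2
    linarith
  set c1 : ℝ := ((2 * k : ℝ) ^ k)⁻¹ with hc1
  have hc1pos : 0 < c1 := by positivity
  let w : u → ℝ := fun i => c1 * (f (Υ i.1.2) / Υ i.1.2 ^ k)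
  have hw0 : ∀ i, 0 ≤ w i := fun i =>
    mul_nonneg hc1pos.le (div_nonneg (hf0 _ (hUpos i).le) (pow_nonneg (hUpos i).le _))
  have hφg : ∀ i : u, f (Υ i.1.2) / Υ i.1.2 ^ k * Υ i.1.2 ^ m = g (Υ i.1.2) := by
    intro i
    have := hUpos i
    have hpk : Υ i.1.2 ^ k = Υ i.1.2 ^ m * Υ i.1.2 ^ l :=
      (congrArg (fun n => Υ i.1.2 ^ n) hk).trans (pow_add _ _ _)
    rw [hgdef _ this, hpk]
    field_simp
  have hmass : ∀ i, w i * ((2 * r i.1.2 / k) ^ l * (Υ i.1.2 / k) ^ m) =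
      c1 * 2 ^ l / k ^ k * D * r i.1.2 ^ k := by
    intro i
    have h1 := (hr _ (hrpos i)).2
    have h2 := hφg i
    calc _ = c1 * 2 ^ l / (k ^ l * k ^ m) * r i.1.2 ^ l *
          (f (Υ i.1.2) / Υ i.1.2 ^ k * Υ i.1.2 ^ m) := by
          simp only [w, div_pow, mul_pow]; ring
      _ = c1 * 2 ^ l / (k ^ l * k ^ m) * r i.1.2 ^ l * (r i.1.2 ^ m * D) := by rw [h2, h1]
      _ = c1 * 2 ^ l / ((k : ℝ) ^ (m + l)) * D * r i.1.2 ^ (m + l) := by rw [pow_add, pow_add]; ring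
      _ = _ := by rw [← hk]
  let ν : Measure (EuclideanSpace ℝ (Fin k)) :=
    ∑ i ∈ I, ENNReal.ofReal (w i) • volume.restrict (T i)
  have hν : ∀ A, ν A = ∑ i ∈ I, ENNReal.ofReal (w i) * volume (T i ∩ A) := by
    intro A
    simp only [ν, Measure.coe_finsetSum, Finset.sum_apply, Measure.smul_apply, smul_eq_mul]
    refine Finset.sum_congr rfl fun i _ => ?_
    rw [Measure.restrict_apply' (hTm i), inter_comm]
  have hmassE : ∀ i, ENNReal.ofReal (w i) * volume (T i) =
      ENNReal.ofReal (c1 * 2 ^ l / k ^ k * D * r i.1.2 ^ k) := by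
    intro i
    rw [hTv, ← ENNReal.ofReal_mul (hw0 i), hmass]
  refine ⟨ν, ⋃ i ∈ I, T i, ∑ i ∈ I, ENNReal.ofReal (w i), ?_, ?_, ?_, ?_, ?_, ?_, ?_, ?_⟩
  · exact I.isCompact_biUnion fun i _ => hTc i
  · refine iUnion₂_subset fun i _ => (hTx i).trans ?_
    have h1 := (hut i.2).1
    have h2 := (hut i.2).2.2.2.1
    refine (Metric.closedBall_subset_ball' (ε₂ := s0 / 2) ?_)
    rw [Metric.mem_ball] at h1
    linarith
  · intro x hx
    obtain ⟨i, -, hxi⟩ := mem_iUnion₂.1 hx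
    exact ⟨i.1.2, (hut i.2).2.1, hUpos i, hTd i x hxi⟩
  · rw [hν]
    refine Finset.sum_eq_zero fun i hi => ?_
    have : T i ∩ (⋃ i ∈ I, T i)ᶜ = ∅ := by
      ext x; simp only [mem_inter_iff, mem_compl_iff, mem_iUnion, mem_empty_iff_false, iff_false]
      rintro ⟨h1, h2⟩
      exact h2 ⟨i, hi, h1⟩
    rw [this]; simp
  · exact ENNReal.sum_ne_top.2 fun i _ => ENNReal.ofReal_ne_top
  · intro A
    rw [hν, Finset.sum_mul]
    refine Finset.sum_le_sum fun i _ => ?_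
    gcongr
    exact inter_subset_right
  · rw [hν]
    simp only [inter_univ]
    rw [Finset.sum_congr rfl fun i _ => hmassE i, ← ENNReal.ofReal_sum_of_nonneg]
    · refine ENNReal.ofReal_le_ofReal ?_
      rw [← Finset.mul_sum]
      have h1 : ∑ i ∈ I, (15 * r i.1.2) ^ k = 15 ^ k * ∑ i ∈ I, r i.1.2 ^ k := by
        rw [Finset.mul_sum]; exact Finset.sum_congr rfl fun i _ => mul_pow _ _ _
      rw [h1] at hI
      have h2 : (60 ^ k * 2)⁻¹ * s0 ^ k ≤ ∑ i ∈ I, r i.1.2 ^ k := by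
        have h3 : (15 : ℝ) ^ k * ((60 ^ k * 2)⁻¹ * s0 ^ k) = (s0 / 4) ^ k / 2 := by
          have : (60 : ℝ) ^ k = 15 ^ k * 4 ^ k := by rw [← mul_pow]; norm_num
          rw [this, div_pow]; field_simp
        rw [← h3] at hI
        exact le_of_mul_le_mul_left hI (by positivity)
      calc ((2 * k : ℝ) ^ k * k ^ k * 60 ^ k * 2)⁻¹ * D * s0 ^ k
          = c1 * 1 / k ^ k * D * ((60 ^ k * 2)⁻¹ * s0 ^ k) := by
            rw [hc1]; field_simp
        _ ≤ c1 * 2 ^ l / k ^ k * D * ∑ i ∈ I, r i.1.2 ^ k := by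
            gcongr
            exact one_le_pow₀ (by norm_num)
    · intro i _
      have := hrpos i
      positivity
  · intro s A hs hss hA
    have hsingle : ∀ i, ENNReal.ofReal (w i) * volume (T i ∩ A) ≤ ENNReal.ofReal (f s) := by
      intro i
      obtain ⟨h1, h2⟩ := hTA i A (k * s) (by positivity) hA
      have hU := hUpos i
      rcases le_total s (Υ i.1.2) with hsU | hsU
      · calc _ ≤ ENNReal.ofReal (w i) * ENNReal.ofReal ((2 * (k * s)) ^ k) := by gcongr
          _ = ENNReal.ofReal (f (Υ i.1.2) / Υ i.1.2 ^ k * s ^ k) := by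
            rw [← ENNReal.ofReal_mul (hw0 i)]
            congr 1
            simp only [w, hc1]
            rw [← mul_assoc 2, mul_pow _ s]
            field_simp
          _ ≤ ENNReal.ofReal (f s) := by
            refine ENNReal.ofReal_le_ofReal ?_
            have := hanti (show s ∈ Ioi 0 from hs) (show Υ i.1.2 ∈ Ioi 0 from hU) hsU
            simp only at this
            calc _ ≤ f s / s ^ k * s ^ k := by gcongr
              _ = f s := by field_simp
      · calc _ ≤ ENNReal.ofReal (w i) * ENNReal.ofReal ((2 * (k * s)) ^ l * (Υ i.1.2 / k) ^ m) := by
              gcongr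
          _ = ENNReal.ofReal (c1 * (2 * k) ^ l / k ^ m * (s ^ l * g (Υ i.1.2))) := by
            rw [← ENNReal.ofReal_mul (hw0 i)]
            congr 1
            rw [← hφg i]
            simp only [w]
            rw [← mul_assoc 2, mul_pow _ s, div_pow]
            ring
          _ ≤ ENNReal.ofReal (f s) := by
            refine ENNReal.ofReal_le_ofReal ?_
            have h3 := hgmono (show Υ i.1.2 ∈ Ici 0 from hU.le) (show s ∈ Ici 0 from hs.le) hsU
            have h4 : s ^ l * g s = f s := by rw [hgdef s hs]; field_simp
            have h5 : c1 * (2 * k) ^ l / (k : ℝ) ^ m ≤ 1 := by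
              rw [div_le_one (by positivity), hc1, inv_mul_le_iff₀ (by positivity)]
              calc (2 * k : ℝ) ^ l ≤ (2 * k) ^ k := pow_le_pow_right₀ (by linarith) (by omega)
                _ = (2 * k) ^ k * 1 := by ring
                _ ≤ _ := by gcongr; exact one_le_pow₀ hk1
            have h6 : 0 ≤ g (Υ i.1.2) := by
              rw [hgdef _ hU]; exact div_nonneg (hf0 _ hU.le) (by positivity)
            rw [← h4]
            calc _ ≤ 1 * (s ^ l * g (Υ i.1.2)) := by gcongr
              _ ≤ s ^ l * g s := by rw [one_mul]; gcongr
    rw [hν]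
    by_cases hmany : ∃ i ∈ I, ∃ j ∈ I, i ≠ j ∧ (T i ∩ A).Nonempty ∧ (T j ∩ A).Nonempty
    · obtain ⟨i0, hi0, j0, hj0, hij0, ⟨a0, ha0⟩, ⟨b0, hb0⟩⟩ := hmany
      have hsep : ∀ i j : u, i ≠ j → (T i ∩ A).Nonempty → (T j ∩ A).Nonempty →
          r i.1.2 ≤ k * s := by
        rintro i j hij ⟨a, haT, haA⟩ ⟨b, hbT, hbA⟩
        have h1 := hdisj i.2 j.2 (fun h => hij (Subtype.ext h))
        have hb1 : b ∈ Metric.closedBall j.1.1 (3 * r j.1.2) :=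
          Metric.closedBall_subset_closedBall (by linarith [hrpos j]) (hTx j hbT)
        have hb2 : b ∉ Metric.closedBall i.1.1 (3 * r i.1.2) :=
          fun h => Set.disjoint_left.1 h1 h hb1
        have h2 := hA b hbA a haA
        have h3 := hTx i haT
        rw [Metric.mem_closedBall] at hb2 h3
        have := dist_triangle b a i.1.1
        linarith
      have hsep' : ∀ i ∈ I, (T i ∩ A).Nonempty → r i.1.2 ≤ k * s := by
        intro i _ hi
        by_cases h : i = i0
        · exact hsep i j0 (h ▸ hij0) hi ⟨b0, hb0⟩
        · exact hsep i i0 h hi ⟨a0, ha0⟩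
      set I' := I.filter fun i => (T i ∩ A).Nonempty with hI'
      have hsub : (⋃ i ∈ I', Metric.closedBall i.1.1 (3 * r i.1.2)) ⊆
          Metric.closedBall a0 (6 * k * s) := by
        refine iUnion₂_subset fun i hi => ?_
        obtain ⟨hiI, hne⟩ := Finset.mem_filter.1 hi
        have h1 := hsep' i hiI hne
        obtain ⟨a, haT, haA⟩ := hne
        have h2 := hA a haA a0 ha0.2
        have h3 := hTx i haT
        refine Metric.closedBall_subset_closedBall' ?_
        rw [Metric.mem_closedBall, dist_comm] at h3
        have := dist_triangle i.1.1 a a0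
        linarith
      have hvol : ∑ i ∈ I', (3 * r i.1.2) ^ k ≤ (6 * k * s) ^ k := by
        have h1 := measure_mono (μ := volume) hsub
        rw [measure_biUnion_finset, hball _ _ (by positivity)] at h1
        · rw [Finset.sum_congr rfl fun i _ => hball _ _ (by linarith [hrpos i]),
            ← ENNReal.ofReal_sum_of_nonneg, ENNReal.ofReal_le_ofReal_iff (by positivity),
            ← Finset.sum_mul] at h1
          · exact le_of_mul_le_mul_right h1 hω
          · intro i _
            have := hrpos i
            positivity
        · intro i _ j _ hij
          exact hdisj i.2 j.2 (fun h => hij (Subtype.ext h))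
        · intro i _
          exact measurableSet_closedBall
      calc ∑ i ∈ I, ENNReal.ofReal (w i) * volume (T i ∩ A)
          = ∑ i ∈ I', ENNReal.ofReal (w i) * volume (T i ∩ A) := by
            rw [hI', Finset.sum_filter_of_ne]
            intro i _ hne
            by_contra h
            rw [not_nonempty_iff_eq_empty] at h
            exact hne (by rw [h]; simp)
        _ ≤ ∑ i ∈ I', ENNReal.ofReal (D * (3 * r i.1.2) ^ k) := by
            refine Finset.sum_le_sum fun i _ => ?_
            calc _ ≤ ENNReal.ofReal (w i) * volume (T i) := by gcongr; exact inter_subset_left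
              _ = _ := hmassE i
              _ ≤ _ := by
                refine ENNReal.ofReal_le_ofReal ?_
                have hri := hrpos i
                have h5 : c1 * 2 ^ l / (k : ℝ) ^ k ≤ 1 := by
                  rw [div_le_one (by positivity), hc1, inv_mul_le_iff₀ (by positivity)]
                  calc (2 : ℝ) ^ l ≤ 2 ^ k := pow_le_pow_right₀ (by norm_num) (by omega)
                    _ ≤ (2 * k) ^ k := by gcongr; linarith
                    _ = (2 * k) ^ k * 1 := by ring
                    _ ≤ _ := by gcongr; exact one_le_pow₀ hk1
                calc _ ≤ 1 * D * r i.1.2 ^ k := by gcongr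
                  _ ≤ D * (3 * r i.1.2) ^ k := by rw [one_mul]; gcongr; linarith
        _ = ENNReal.ofReal (D * ∑ i ∈ I', (3 * r i.1.2) ^ k) := by
            rw [← ENNReal.ofReal_sum_of_nonneg, Finset.mul_sum]
            intro i _
            have := hrpos i
            positivity
        _ ≤ ENNReal.ofReal (f s) := by
            refine ENNReal.ofReal_le_ofReal (le_trans ?_ (hfs s hs hss))
            calc _ ≤ D * (6 * k * s) ^ k := by gcongr
              _ = _ := by rw [mul_pow _ s]; ring
    · push Not at hmany
      by_cases hone : ∃ i ∈ I, (T i ∩ A).Nonempty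
      · obtain ⟨i, hi, hne⟩ := hone
        rw [Finset.sum_eq_single i]
        · exact hsingle i
        · intro j hj hji
          rw [hmany i hi j hj hji.symm hne]; simp
        · intro h; exact absurd hi h
      · push Not at hone
        rw [Finset.sum_eq_zero]
        · exact zero_le
        · intro i hi
          rw [hone i hi]; simp

/-- The dyadic address of a point at level `n`. -/
noncomputable def dyad {k : ℕ} (n : ℕ) (x : EuclideanSpace ℝ (Fin k)) : Fin k → ℤ :=
  fun i => ⌊(2 : ℝ) ^ n * x i⌋

/-- Half-open dyadic cube. -/
def dcube {k : ℕ} (n : ℕ) (z : Fin k → ℤ) : Set (EuclideanSpace ℝ (Fin k)) :=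
  {x | dyad n x = z}

lemma mem_dcube {k : ℕ} {n : ℕ} {z : Fin k → ℤ} {x : EuclideanSpace ℝ (Fin k)} :
    x ∈ dcube n z ↔ dyad n x = z := Iff.rfl

lemma dcube_measurable {k : ℕ} (n : ℕ) (z : Fin k → ℤ) : MeasurableSet (dcube n z) := by
  have : dcube n z = ⋂ i, (fun x : EuclideanSpace ℝ (Fin k) => ⌊(2 : ℝ) ^ n * x i⌋) ⁻¹' {z i} := by
    ext x; simp [dcube, dyad, funext_iff]
  rw [this]
  refine MeasurableSet.iInter fun i => ?_
  refine measurableSet_preimage ?_ (measurableSet_singleton _)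
  exact Int.measurable_floor.comp (by fun_prop)

lemma dcube_bounds {k : ℕ} {n : ℕ} {z : Fin k → ℤ} {x : EuclideanSpace ℝ (Fin k)}
    (hx : x ∈ dcube n z) (i : Fin k) :
    z i * (1 / 2 : ℝ) ^ n ≤ x i ∧ x i ≤ (z i + 1) * (1 / 2 : ℝ) ^ n := by
  have h := congrFun (mem_dcube.1 hx) i
  rw [dyad, Int.floor_eq_iff] at h
  have h2 : (0 : ℝ) < (1 / 2) ^ n := by positivity
  have h3 : (1 / 2 : ℝ) ^ n * 2 ^ n = 1 := by rw [← mul_pow]; norm_num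
  constructor
  · calc z i * (1 / 2 : ℝ) ^ n ≤ (2 ^ n * x i) * (1 / 2 : ℝ) ^ n := by gcongr; exact h.1
      _ = ((1 / 2 : ℝ) ^ n * 2 ^ n) * x i := by ring
      _ = x i := by rw [h3, one_mul]
  · calc x i = ((1 / 2 : ℝ) ^ n * 2 ^ n) * x i := by rw [h3, one_mul]
      _ = (2 ^ n * x i) * (1 / 2 : ℝ) ^ n := by ring
      _ ≤ _ := by gcongr; exact h.2.le

lemma dcube_volume_le {k : ℕ} (n : ℕ) (z : Fin k → ℤ) :
    volume (dcube n z) ≤ ENNReal.ofReal (((1 / 2 : ℝ) ^ n) ^ k) := by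
  calc volume (dcube n z) ≤ volume {w : EuclideanSpace ℝ (Fin k) |
        ∀ j, (EuclideanSpace.basisFun (Fin k) ℝ).repr w j ∈
          Icc (z j * (1 / 2 : ℝ) ^ n) ((z j + 1) * (1 / 2 : ℝ) ^ n)} := by
        refine measure_mono fun x hx j => ?_
        simpa using dcube_bounds hx j
    _ = _ := by
      rw [vol_box, ENNReal.ofReal_pow (by positivity)]
      have : ∀ j, ((z j : ℝ) + 1) * (1 / 2 : ℝ) ^ n - z j * (1 / 2 : ℝ) ^ n = (1 / 2) ^ n := by
        intro j; ring
      simp only [this]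
      simp

lemma dist_le_of_coord {k : ℕ} (x y : EuclideanSpace ℝ (Fin k)) (s : ℝ)
    (h : ∀ i, |x i - y i| ≤ s) : dist x y ≤ k * s := by
  have h1 := (EuclideanSpace.basisFun (Fin k) ℝ).sum_repr (x - y)
  have h2 := norm_sum_basis_le (EuclideanSpace.basisFun (Fin k) ℝ) id (fun i => x i - y i) s h
  rw [dist_eq_norm, ← h1]
  simpa using h2

lemma dcube_dist {k : ℕ} {n : ℕ} {z : Fin k → ℤ} {x y : EuclideanSpace ℝ (Fin k)}
    (hx : x ∈ dcube n z) (hy : y ∈ dcube n z) : dist x y ≤ k * (1 / 2 : ℝ) ^ n := by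
  refine dist_le_of_coord _ _ _ fun i => ?_
  have h1 := dcube_bounds hx i
  have h2 := dcube_bounds hy i
  rw [abs_le]; constructor <;> linarith [h1.1, h1.2, h2.1, h2.2]

lemma dyad_nested_succ {k : ℕ} {n : ℕ} {x y : EuclideanSpace ℝ (Fin k)}
    (h : dyad (n + 1) x = dyad (n + 1) y) : dyad n x = dyad n y := by
  have key : ∀ (w : EuclideanSpace ℝ (Fin k)) i, dyad n w i = dyad (n + 1) w i / 2 := by
    intro w i
    have := Int.floor_div_natCast ((2 : ℝ) ^ (n + 1) * w i) 2
    simp only [dyad]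
    rw [Nat.cast_ofNat, Nat.cast_ofNat] at this
    rw [← this]
    congr 1
    rw [pow_succ]; ring
  ext i
  rw [key, key, h]

lemma dyad_nested {k : ℕ} {n n' : ℕ} (hn : n ≤ n') {x y : EuclideanSpace ℝ (Fin k)}
    (h : dyad n' x = dyad n' y) : dyad n x = dyad n y := by
  induction n', hn using Nat.le_induction with
  | base => exact h
  | succ p _ ih => exact ih (dyad_nested_succ h)

lemma ball_subset_dcube {k : ℕ} (n : ℕ) (z : Fin k → ℤ) :
    ∃ c : EuclideanSpace ℝ (Fin k), Metric.ball c ((1 / 2 : ℝ) ^ n / 2) ⊆ dcube n z := by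
  refine ⟨WithLp.toLp 2 fun i => (z i + 1 / 2) * (1 / 2 : ℝ) ^ n, fun x hx => ?_⟩
  rw [mem_dcube]
  ext i
  rw [dyad, Int.floor_eq_iff]
  rw [Metric.mem_ball] at hx
  have h1 := (repr_sub_le (EuclideanSpace.basisFun (Fin k) ℝ) x
    (WithLp.toLp 2 fun i => (z i + 1 / 2) * (1 / 2 : ℝ) ^ n) i).trans_lt hx
  simp only [EuclideanSpace.basisFun_repr] at h1
  rw [abs_lt] at h1
  have h3 : (2 : ℝ) ^ n * (1 / 2 : ℝ) ^ n = 1 := by rw [← mul_pow]; norm_num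
  have h2 : (0 : ℝ) < 2 ^ n := by positivity
  have e1 : (2 : ℝ) ^ n * ((z i : ℝ) * (1 / 2 : ℝ) ^ n) = z i := by
    rw [mul_left_comm, h3, mul_one]
  have e2 : (2 : ℝ) ^ n * (((z i : ℝ) + 1) * (1 / 2 : ℝ) ^ n) = z i + 1 := by
    rw [mul_left_comm, h3, mul_one]
  constructor
  · rw [← e1]
    refine mul_le_mul_of_nonneg_left ?_ h2.le
    linarith [h1.1]
  · rw [← e2]
    refine mul_lt_mul_of_pos_left ?_ h2
    linarith [h1.2]

lemma dyad_image_finite {k : ℕ} (n : ℕ) {K : Set (EuclideanSpace ℝ (Fin k))}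
    (hK : Bornology.IsBounded K) : (dyad n '' K).Finite := by
  obtain ⟨M, hM⟩ := hK.subset_closedBall 0
  refine (Set.finite_Icc (fun _ : Fin k => ⌊-((2 : ℝ) ^ n * M)⌋) (fun _ => ⌊(2 : ℝ) ^ n * M⌋)).subset ?_
  rintro _ ⟨x, hx, rfl⟩
  have h1 : ∀ i, |x i| ≤ M := by
    intro i
    have := repr_sub_le (EuclideanSpace.basisFun (Fin k) ℝ) x 0 i
    have h2 := hM hx
    rw [Metric.mem_closedBall] at h2
    simp at this h2
    linarith
  have h2 : (0 : ℝ) < 2 ^ n := by positivity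
  constructor
  · intro i
    refine Int.floor_le_floor ?_
    have := (abs_le.1 (h1 i)).1
    nlinarith
  · intro i
    refine Int.floor_le_floor ?_
    have := (abs_le.1 (h1 i)).2
    nlinarith

lemma step_lemma {k : ℕ} (f : ℝ → ℝ) (n0 : ℕ)
    (μ : Measure (EuclideanSpace ℝ (Fin k))) (D : ℝ) (hD : 0 < D)
    (hμD : ∀ A, μ A ≤ ENNReal.ofReal D * volume A)
    (K W O : Set (EuclideanSpace ℝ (Fin k))) (hK : IsCompact K) (hW : IsOpen W) (hKW : K ⊆ W)
    (hμK : μ Kᶜ = 0)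
    (hμf : ∀ n ≥ n0, ∀ z, μ (dcube n z) ≤ ENNReal.ofReal (f ((1 / 2) ^ n)))
    (hloc : ∃ p0, ∀ p ≥ p0, ∀ z : Fin k → ℤ, dcube p z ⊆ W →
      ∃ (ν : Measure (EuclideanSpace ℝ (Fin k))) (L : Set (EuclideanSpace ℝ (Fin k))) (D' : ℝ≥0∞),
        IsCompact L ∧ L ⊆ dcube p z ∧ L ⊆ O ∧ ν Lᶜ = 0 ∧ D' ≠ ∞ ∧ (∀ A, ν A ≤ D' * volume A) ∧
        ENNReal.ofReal (D * ((1 / 2 : ℝ) ^ p) ^ k) ≤ ν univ ∧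
        ∀ n ≥ p, ∀ z', ν (dcube n z') ≤ ENNReal.ofReal (f ((1 / 2) ^ n))) :
    ∃ (μ' : Measure (EuclideanSpace ℝ (Fin k))) (D' : ℝ) (K' : Set (EuclideanSpace ℝ (Fin k))),
      0 < D' ∧ (∀ A, μ' A ≤ ENNReal.ofReal D' * volume A) ∧ IsCompact K' ∧ K' ⊆ W ∧ K' ⊆ O ∧
      μ' K'ᶜ = 0 ∧ μ' univ = μ univ ∧
      (∀ n ≥ n0, ∀ z, μ' (dcube n z) ≤ ENNReal.ofReal (f ((1 / 2) ^ n))) := by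
  classical
  obtain ⟨p0, hloc⟩ := hloc
  obtain ⟨ε, hε, hεW⟩ := hK.exists_thickening_subset_open hW hKW
  obtain ⟨p, hpp0, hpε⟩ : ∃ p ≥ p0, k * (1 / 2 : ℝ) ^ p < ε := by
    have h1 : Tendsto (fun p : ℕ => k * (1 / 2 : ℝ) ^ p) atTop (nhds (k * 0)) :=
      (tendsto_pow_atTop_nhds_zero_of_lt_one (by norm_num) (by norm_num)).const_mul _
    rw [mul_zero] at h1
    exact ((eventually_ge_atTop p0).and (h1.eventually_lt_const hε)).exists
  have hZfin := dyad_image_finite p hK.isBounded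
  set Z := hZfin.toFinset with hZ
  have hQW : ∀ z ∈ Z, dcube p z ⊆ W := by
    intro z hz
    rw [hZ, Set.Finite.mem_toFinset] at hz
    obtain ⟨x, hx, rfl⟩ := hz
    intro w hw
    refine hεW (Metric.mem_thickening_iff.2 ⟨x, hx, ?_⟩)
    exact (dcube_dist hw (mem_dcube.2 rfl)).trans_lt hpε
  have hex := fun z (hz : z ∈ Z) => hloc p hpp0 z (hQW z hz)
  choose! ν L E hL hLQ hLO hνL hE hνE hνl hνf using hex
  have hνfin : ∀ z ∈ Z, ν z univ ≠ ∞ := by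
    intro z hz
    have h1 : ν z univ ≤ ν z (L z) + ν z (L z)ᶜ := by
      rw [← union_compl_self (L z)]; exact measure_union_le _ _
    rw [hνL z hz, add_zero] at h1
    exact ne_top_of_le_ne_top (ENNReal.mul_ne_top (hE z hz) (hL z hz).measure_lt_top.ne)
      (h1.trans (hνE z hz _))
  have hν0 : ∀ z ∈ Z, ν z univ ≠ 0 := by
    intro z hz h
    have h1 := hνl z hz
    rw [h, nonpos_iff_eq_zero, ENNReal.ofReal_eq_zero] at h1
    have : 0 < D * ((1 / 2 : ℝ) ^ p) ^ k := by positivity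
    linarith
  have hμν : ∀ z ∈ Z, μ (dcube p z) ≤ ν z univ := by
    intro z hz
    refine ((hμD _).trans ?_).trans (hνl z hz)
    rw [ENNReal.ofReal_mul hD.le]
    gcongr
    exact dcube_volume_le p z
  have hνout : ∀ z ∈ Z, ∀ A, Disjoint (dcube p z) A → ν z A = 0 := by
    intro z hz A hA
    refine measure_mono_null ?_ (hνL z hz)
    intro x hxA hxL
    exact Set.disjoint_left.1 hA (hLQ z hz hxL) hxA
  let a : (Fin k → ℤ) → ℝ≥0∞ := fun z => μ (dcube p z) / ν z univ
  have ha1 : ∀ z ∈ Z, a z ≤ 1 := fun z hz => ENNReal.div_le_of_le_mul (by rw [one_mul]; exact hμν z hz)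
  have haν : ∀ z ∈ Z, a z * ν z univ = μ (dcube p z) := fun z hz =>
    ENNReal.div_mul_cancel (hν0 z hz) (hνfin z hz)
  let μ' : Measure (EuclideanSpace ℝ (Fin k)) := ∑ z ∈ Z, a z • ν z
  have hμ' : ∀ A, μ' A = ∑ z ∈ Z, a z * ν z A := by
    intro A
    simp only [μ', Measure.coe_finsetSum, Finset.sum_apply, Measure.smul_apply, smul_eq_mul]
  have hdisj : ∀ z z' : Fin k → ℤ, z ≠ z' → Disjoint (dcube (k := k) p z) (dcube p z') := by
    intro z z' h
    rw [Set.disjoint_left]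
    intro x h1 h2
    exact h (h1.symm.trans h2)
  have hEsum : ∑ z ∈ Z, E z ≠ ∞ := ENNReal.sum_ne_top.2 hE
  refine ⟨μ', (∑ z ∈ Z, E z).toReal + 1, ⋃ z ∈ Z, L z, by positivity, ?_, ?_, ?_, ?_, ?_, ?_, ?_⟩
  · intro A
    rw [hμ']
    calc ∑ z ∈ Z, a z * ν z A ≤ ∑ z ∈ Z, E z * volume A := by
          refine Finset.sum_le_sum fun z hz => ?_
          calc a z * ν z A ≤ 1 * ν z A := by gcongr; exact ha1 z hz
            _ ≤ _ := by rw [one_mul]; exact hνE z hz A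
      _ = (∑ z ∈ Z, E z) * volume A := by rw [Finset.sum_mul]
      _ ≤ _ := by
        gcongr
        rw [← ENNReal.ofReal_toReal hEsum]
        refine ENNReal.ofReal_le_ofReal ?_
        rw [ENNReal.ofReal_toReal hEsum]
        linarith
  · exact Z.isCompact_biUnion hL
  · exact iUnion₂_subset fun z hz => (hLQ z hz).trans (hQW z hz)
  · exact iUnion₂_subset fun z hz => hLO z hz
  · rw [hμ']
    refine Finset.sum_eq_zero fun z hz => ?_
    rw [measure_mono_null _ (hνL z hz), mul_zero]
    exact compl_subset_compl.2 (subset_biUnion_of_mem (u := L) (show z ∈ (Z : Set _) from hz))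
  · rw [hμ', Finset.sum_congr rfl haν]
    rw [← measure_biUnion_finset (fun z _ z' _ h => hdisj z z' h) (fun z _ => dcube_measurable p z)]
    refine le_antisymm (measure_mono (subset_univ _)) ?_
    have h1 : (univ : Set (EuclideanSpace ℝ (Fin k))) ⊆ (⋃ z ∈ Z, dcube p z) ∪ Kᶜ := by
      intro x _
      by_cases hx : x ∈ K
      · left
        refine mem_iUnion₂.2 ⟨dyad p x, ?_, mem_dcube.2 rfl⟩
        rw [hZ, Set.Finite.mem_toFinset]
        exact ⟨x, hx, rfl⟩
      · exact Or.inr hx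
    calc μ univ ≤ μ ((⋃ z ∈ Z, dcube p z) ∪ Kᶜ) := measure_mono h1
      _ ≤ _ := measure_union_le _ _
      _ = _ := by rw [hμK, add_zero]
  · intro n hn z'
    rcases le_total n p with hnp | hpn
    · refine le_trans ?_ (hμf n hn z')
      rw [hμ']
      calc ∑ z ∈ Z, a z * ν z (dcube n z') ≤ ∑ z ∈ Z, μ (dcube p z ∩ dcube n z') := by
            refine Finset.sum_le_sum fun z hz => ?_
            by_cases h : Disjoint (dcube (k := k) p z) (dcube n z')
            · rw [hνout z hz _ h, mul_zero]; exact zero_le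
            · obtain ⟨x, hx1, hx2⟩ := Set.not_disjoint_iff.1 h
              have hsub : dcube p z ∩ dcube n z' = dcube p z := by
                refine inter_eq_left.2 fun y hy => ?_
                have h3 : dyad p y = dyad p x := hy.trans hx1.symm
                exact (dyad_nested hnp h3).trans hx2
              rw [hsub, ← haν z hz]
              gcongr
              exact subset_univ _
        _ = μ (⋃ z ∈ Z, (dcube p z ∩ dcube n z')) := by
            rw [measure_biUnion_finset]
            · intro z _ z1 _ h
              exact (hdisj z z1 h).mono inter_subset_left inter_subset_left
            · exact fun z _ => (dcube_measurable p z).inter (dcube_measurable n z')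
        _ ≤ μ (dcube n z') := measure_mono (iUnion₂_subset fun z _ => inter_subset_right)
    · rw [hμ']
      by_cases h : ∃ z ∈ Z, ¬ Disjoint (dcube (k := k) p z) (dcube n z')
      · obtain ⟨z, hz, hnd⟩ := h
        obtain ⟨x, hx1, hx2⟩ := Set.not_disjoint_iff.1 hnd
        rw [Finset.sum_eq_single z]
        · calc a z * ν z (dcube n z') ≤ 1 * ν z (dcube n z') := by gcongr; exact ha1 z hz
            _ ≤ _ := by rw [one_mul]; exact hνf z hz n hpn z'
        · intro z1 hz1 hne
          rw [hνout z1 hz1, mul_zero]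
          rw [Set.disjoint_left]
          intro y hy1 hy2
          have h3 : dyad n y = dyad n x := hy2.trans hx2.symm
          exact hne (hy1.symm.trans ((dyad_nested hpn h3).trans hx1))
        · intro h; exact absurd hz h
      · push Not at h
        rw [Finset.sum_eq_zero]
        · exact zero_le
        · intro z hz
          rw [hνout z hz _ (h z hz), mul_zero]

lemma cover_bound {k : ℕ} (f : ℝ → ℝ) (hf0 : ∀ r, 0 ≤ r → 0 ≤ f r)
    (hfmono : MonotoneOn f (Set.Ici 0))
    (hanti : AntitoneOn (fun r => f r / r ^ k) (Set.Ioi 0)) (n0 : ℕ)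
    (μ : Measure (EuclideanSpace ℝ (Fin k)))
    (hμf : ∀ n ≥ n0, ∀ z, μ (dcube n z) ≤ ENNReal.ofReal (f ((1 / 2) ^ n)))
    (A : Set (EuclideanSpace ℝ (Fin k))) (e : ℝ) (he : 0 < e) (hen : e < (1 / 2) ^ n0)
    (hA : ∀ a ∈ A, ∀ a' ∈ A, dist a a' ≤ e) :
    μ A ≤ 6 ^ k * ENNReal.ofReal (f e) := by
  rcases A.eq_empty_or_nonempty with rfl | ⟨a, ha⟩
  · simp
  have he1 : e ≤ 1 := hen.le.trans (pow_le_one₀ (by norm_num) (by norm_num))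
  obtain ⟨n, hn1, hn2⟩ := exists_nat_pow_near_of_lt_one he he1
    (show (0 : ℝ) < 1 / 2 by norm_num) (by norm_num)
  have hnn0 : n0 ≤ n := by
    have h1 := hn1.trans hen
    have := (pow_lt_pow_iff_right_of_lt_one₀ (show (0 : ℝ) < 1 / 2 by norm_num) (by norm_num)).1 h1
    omega
  let Z : Finset (Fin k → ℤ) :=
    Fintype.piFinset fun i => Finset.Icc (dyad n a i - 1) (dyad n a i + 1)
  have hZ : Z.card = 3 ^ k := by
    simp only [Z, Fintype.card_piFinset, Int.card_Icc]
    have : ∀ i, (dyad n a i + 1 + 1 - (dyad n a i - 1)).toNat = 3 := by intro i; omega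
    simp [this]
  have hcov : A ⊆ ⋃ z ∈ Z, dcube n z := by
    intro y hy
    refine mem_iUnion₂.2 ⟨dyad n y, ?_, mem_dcube.2 rfl⟩
    rw [Fintype.mem_piFinset]
    intro i
    have h1 := (repr_sub_le (EuclideanSpace.basisFun (Fin k) ℝ) y a i).trans
      ((hA y hy a ha).trans hn2)
    simp only [EuclideanSpace.basisFun_repr] at h1
    rw [abs_le] at h1
    have h2 : (0 : ℝ) < 2 ^ n := by positivity
    have h3 : (2 : ℝ) ^ n * (1 / 2 : ℝ) ^ n = 1 := by rw [← mul_pow]; norm_num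
    have h4 : (2 : ℝ) ^ n * y i ≤ 2 ^ n * a i + 1 := by
      have := mul_le_mul_of_nonneg_left h1.2 h2.le
      linarith
    have h5 : (2 : ℝ) ^ n * a i ≤ 2 ^ n * y i + 1 := by
      have := mul_le_mul_of_nonneg_left h1.1 h2.le
      linarith
    have h6 := Int.floor_le_floor h4
    have h7 := Int.floor_le_floor h5
    rw [Int.floor_add_one] at h6 h7
    rw [Finset.mem_Icc]
    simp only [dyad]
    constructor <;> linarith
  have hf1 : f ((1 / 2) ^ n) ≤ 2 ^ k * f e := by
    have h1 : f ((1 / 2) ^ n) ≤ f (2 * e) := by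
      refine hfmono (show _ ∈ Ici (0 : ℝ) from by simp) (show _ ∈ Ici (0 : ℝ) from by
        simp only [mem_Ici]; positivity) ?_
      rw [pow_succ] at hn1
      linarith
    have h2 := hanti (show e ∈ Ioi 0 from he) (show 2 * e ∈ Ioi 0 from by
      simp only [mem_Ioi]; positivity) (by linarith)
    simp only at h2
    rw [div_le_div_iff₀ (by positivity) (by positivity), mul_pow] at h2
    have h3 : 0 < e ^ k := by positivity
    refine h1.trans (le_of_mul_le_mul_right ?_ h3)
    linarith
  calc μ A ≤ μ (⋃ z ∈ Z, dcube n z) := measure_mono hcov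
    _ ≤ ∑ z ∈ Z, μ (dcube n z) := measure_biUnion_finset_le _ _
    _ ≤ ∑ z ∈ Z, ENNReal.ofReal (f ((1 / 2) ^ n)) := Finset.sum_le_sum fun z _ => hμf n hnn0 z
    _ = 3 ^ k * ENNReal.ofReal (f ((1 / 2) ^ n)) := by
        rw [Finset.sum_const, hZ, nsmul_eq_mul]; push_cast; rfl
    _ ≤ 3 ^ k * ENNReal.ofReal (2 ^ k * f e) := by gcongr
    _ = 6 ^ k * ENNReal.ofReal (f e) := by
        rw [ENNReal.ofReal_mul (by positivity), ENNReal.ofReal_pow (by norm_num),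
          ENNReal.ofReal_ofNat, ← mul_assoc, ← mul_pow]
        norm_num

lemma hMeasure_lower {k : ℕ} (f : ℝ → ℝ) (hfc : ContinuousOn f (Set.Ici 0))
    (hf0 : ∀ r, 0 ≤ r → 0 ≤ f r) (hfmono : MonotoneOn f (Set.Ici 0))
    (hanti : AntitoneOn (fun r => f r / r ^ k) (Set.Ioi 0)) (n0 : ℕ) (v : ℝ≥0∞)
    (μ : ℕ → Measure (EuclideanSpace ℝ (Fin k)))
    (hμf : ∀ j, ∀ n ≥ n0, ∀ z, μ j (dcube n z) ≤ ENNReal.ofReal (f ((1 / 2) ^ n)))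
    (hv : ∀ j, μ j univ = v) (C : ℕ → Set (EuclideanSpace ℝ (Fin k)))
    (hC : ∀ j, IsCompact (C j)) (hCanti : Antitone C) (hμC : ∀ j, μ j (C j)ᶜ = 0) :
    v / 6 ^ k ≤ hMeasure f (⋂ j, C j) := by
  rw [hMeasure, Measure.mkMetric_apply]
  refine le_trans ?_ (le_iSup₂ (ENNReal.ofReal ((1 / 2) ^ (n0 + 1)))
    (ENNReal.ofReal_pos.2 (by positivity)))
  refine le_iInf fun t => le_iInf fun htc => le_iInf fun htd => ?_
  refine ENNReal.div_le_of_le_mul' ?_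
  refine ENNReal.le_of_forall_pos_le_add fun ε hε _ => ?_
  have h6 : (6 : ℝ≥0∞) ^ k ≠ 0 := by positivity
  have h6' : (6 : ℝ≥0∞) ^ k ≠ ∞ := ENNReal.pow_ne_top (by norm_num)
  obtain ⟨ε', hε'pos, hε'sum⟩ := ENNReal.exists_pos_sum_of_countable
    (ε := (ε : ℝ≥0∞) / 6 ^ k) (ENNReal.div_pos (by exact_mod_cast hε.ne') h6').ne' ℕ
  have hdlt : ∀ i, (Metric.ediam (t i)).toReal ≤ (1 / 2) ^ (n0 + 1) := fun i =>
    ENNReal.toReal_le_of_le_ofReal (by positivity) (htd i)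
  have hδ : ∀ i, ∃ δ > 0, (Metric.ediam (t i)).toReal + 2 * δ < (1 / 2) ^ n0 ∧
      f ((Metric.ediam (t i)).toReal + 2 * δ) ≤ f (Metric.ediam (t i)).toReal + ε' i := by
    intro i
    set d := (Metric.ediam (t i)).toReal with hd
    have hd0 : 0 ≤ d := ENNReal.toReal_nonneg
    have hc0 : Tendsto (fun δ : ℝ => d + 2 * δ) (nhdsWithin 0 (Ioi 0)) (nhds d) := by
      have : Tendsto (fun δ : ℝ => d + 2 * δ) (nhds 0) (nhds (d + 2 * 0)) := by
        exact Continuous.tendsto (by fun_prop) 0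
      rw [mul_zero, add_zero] at this
      exact this.mono_left nhdsWithin_le_nhds
    have hc1 : Tendsto (fun δ : ℝ => d + 2 * δ) (nhdsWithin 0 (Ioi 0)) (nhdsWithin d (Ici 0)) := by
      refine tendsto_nhdsWithin_iff.2 ⟨hc0, ?_⟩
      filter_upwards [self_mem_nhdsWithin] with δ hδ
      have : (0 : ℝ) < δ := hδ
      simp only [mem_Ici]; positivity
    have hc2 := (hfc d hd0).tendsto.comp hc1
    have hlt : d < (1 / 2) ^ n0 := by
      refine (hdlt i).trans_lt ?_
      exact pow_lt_pow_right_of_lt_one₀ (by norm_num) (by norm_num) (by omega)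
    have hev := ((hc0.eventually_lt_const hlt).and
      (hc2.eventually_lt_const (show f d < f d + ε' i by
        have := hε'pos i
        have : (0 : ℝ) < ε' i := by exact_mod_cast this
        linarith))).and self_mem_nhdsWithin
    obtain ⟨δ, ⟨h1, h2⟩, h3⟩ := hev.exists
    exact ⟨δ, h3, h1, h2.le⟩
  choose δ hδpos hδlt hδf using hδ
  let U : ℕ → Set (EuclideanSpace ℝ (Fin k)) := fun i => Metric.thickening (δ i) (t i)
  obtain ⟨j, hj⟩ : ∃ j, C j ⊆ ⋃ i, U i := by
    refine exists_subset_nhds_of_isCompact (directed_of_isDirected_le hCanti) hC fun x hx => ?_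
    refine (isOpen_iUnion fun i => Metric.isOpen_thickening).mem_nhds ?_
    obtain ⟨i, hi⟩ := mem_iUnion.1 (htc hx)
    exact mem_iUnion.2 ⟨i, Metric.self_subset_thickening (hδpos i) _ hi⟩
  have hU : ∀ i, μ j (U i) ≤ 6 ^ k * ((⨆ _ : (t i).Nonempty,
      ENNReal.ofReal (f (Metric.ediam (t i)).toReal)) + ε' i) := by
    intro i
    rcases (t i).eq_empty_or_nonempty with h | h
    · simp [U, h]
    · have hne : Metric.ediam (t i) ≠ ∞ := ne_top_of_le_ne_top ENNReal.ofReal_ne_top (htd i)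
      have hd0 : 0 ≤ (Metric.ediam (t i)).toReal := ENNReal.toReal_nonneg
      have hδi := hδpos i
      refine (cover_bound f hf0 hfmono hanti n0 (μ j) (hμf j) (U i) _ (by positivity) (hδlt i) ?_).trans ?_
      · intro a ha b hb
        obtain ⟨a', ha', haa⟩ := Metric.mem_thickening_iff.1 ha
        obtain ⟨b', hb', hbb⟩ := Metric.mem_thickening_iff.1 hb
        have h1 : dist a' b' ≤ (Metric.ediam (t i)).toReal := by
          rw [dist_edist]
          exact ENNReal.toReal_mono hne (Metric.edist_le_ediam_of_mem ha' hb')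
        have h2 := dist_triangle4 a a' b' b
        rw [dist_comm b' b] at h2
        linarith
      · gcongr
        simp only [h, iSup_pos]
        refine (ENNReal.ofReal_le_ofReal (hδf i)).trans ?_
        rw [ENNReal.ofReal_add (hf0 _ hd0) (by positivity), ENNReal.ofReal_coe_nnreal]
  calc v = μ j univ := (hv j).symm
    _ ≤ μ j (⋃ i, U i) + μ j (C j)ᶜ := by
        refine le_trans (measure_mono ?_) (measure_union_le _ _)
        intro x _
        by_cases hx : x ∈ C j
        · exact Or.inl (hj hx)
        · exact Or.inr hx
    _ = μ j (⋃ i, U i) := by rw [hμC, add_zero]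
    _ ≤ ∑' i, μ j (U i) := measure_iUnion_le _
    _ ≤ ∑' i, 6 ^ k * ((⨆ _ : (t i).Nonempty,
      ENNReal.ofReal (f (Metric.ediam (t i)).toReal)) + ε' i) := ENNReal.tsum_le_tsum hU
    _ = 6 ^ k * ∑' i, (⨆ _ : (t i).Nonempty,
      ENNReal.ofReal (f (Metric.ediam (t i)).toReal)) + 6 ^ k * ∑' i, (ε' i : ℝ≥0∞) := by
        rw [ENNReal.tsum_mul_left, ENNReal.tsum_add, mul_add]
    _ ≤ _ := by
        gcongr
        calc (6 : ℝ≥0∞) ^ k * ∑' i, (ε' i : ℝ≥0∞) ≤ 6 ^ k * (ε / 6 ^ k) := by gcongr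
          _ = ε := ENNReal.mul_div_cancel h6 h6'

lemma lam_iff {k : ℕ} {J : Type*} (R : J → AffineSubspace ℝ (EuclideanSpace ℝ (Fin k)))
    (U : J → ℝ) (x : EuclideanSpace ℝ (Fin k)) :
    x ∈ Lam R U ↔ ∀ F : Finset J, ∃ α ∉ F, 0 < U α ∧
      Metric.infDist x (R α : Set (EuclideanSpace ℝ (Fin k))) < U α := by
  constructor
  · intro h F
    obtain ⟨α, h1, h2⟩ := Set.Infinite.exists_notMem_finset h F
    exact ⟨α, h2, h1⟩
  · intro h hfin
    obtain ⟨α, h1, h2⟩ := h hfin.toFinset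
    exact h1 (hfin.mem_toFinset.2 h2)

lemma nbhd_open {k : ℕ} {J : Type*} (R : J → AffineSubspace ℝ (EuclideanSpace ℝ (Fin k)))
    (U : J → ℝ) (F : Finset J) :
    IsOpen {x | ∃ α ∉ F, 0 < U α ∧
      Metric.infDist x (R α : Set (EuclideanSpace ℝ (Fin k))) < U α} := by
  have : {x | ∃ α ∉ F, 0 < U α ∧
      Metric.infDist x (R α : Set (EuclideanSpace ℝ (Fin k))) < U α} =
      ⋃ α, ⋃ (_ : α ∉ F), ⋃ (_ : 0 < U α),
        {x | Metric.infDist x (R α : Set (EuclideanSpace ℝ (Fin k))) < U α} := by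
    ext x
    simp only [mem_ofPred_eq, mem_iUnion, exists_prop]
  rw [this]
  exact isOpen_iUnion fun α => isOpen_iUnion fun _ => isOpen_iUnion fun _ =>
    isOpen_lt (Metric.continuous_infDist_pt _) continuous_const

lemma lam_measurable {k : ℕ} {J : Type*} [Countable J]
    (R : J → AffineSubspace ℝ (EuclideanSpace ℝ (Fin k)))
    (U : J → ℝ) : MeasurableSet (Lam R U) := by
  have : Lam R U = ⋂ F : Finset J, {x | ∃ α ∉ F, 0 < U α ∧
      Metric.infDist x (R α : Set (EuclideanSpace ℝ (Fin k))) < U α} := by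
    ext x
    rw [lam_iff]; simp
  rw [this]
  exact MeasurableSet.iInter fun F => (nbhd_open R U F).measurableSet

lemma lam_eq_blimsup {k : ℕ} {J : Type*} (e : ℕ ≃ J)
    (R : J → AffineSubspace ℝ (EuclideanSpace ℝ (Fin k)))
    (hRne : ∀ α, (R α : Set (EuclideanSpace ℝ (Fin k))).Nonempty)
    (U : J → ℝ) : Lam R U = blimsup (fun i => Metric.thickening (U (e i))
      (R (e i) : Set (EuclideanSpace ℝ (Fin k)))) atTop (fun _ => True) := by
  rw [← Nat.cofinite_eq_atTop, cofinite.blimsup_set_eq]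
  ext x
  simp only [Lam, mem_ofPred_eq, true_and]
  have : {n | x ∈ Metric.thickening (U (e n)) (R (e n) : Set (EuclideanSpace ℝ (Fin k)))} =
      e ⁻¹' {α | 0 < U α ∧ Metric.infDist x (R α : Set (EuclideanSpace ℝ (Fin k))) < U α} := by
    ext n
    simp only [mem_ofPred_eq, mem_preimage]
    rw [Metric.mem_thickening_iff_infDist_lt (hRne _)]
    exact ⟨fun h => ⟨Metric.infDist_nonneg.trans_lt h, h⟩, fun h => h.2⟩
  rw [this, not_iff_not.symm, Set.not_infinite, Set.not_infinite]
  exact ⟨fun h => h.preimage e.injective.injOn, fun h => h.of_preimage e.surjective⟩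

lemma lam_mul_ae {k : ℕ} {J : Type*} [Countable J] [Infinite J]
    (R : J → AffineSubspace ℝ (EuclideanSpace ℝ (Fin k)))
    (hRne : ∀ α, (R α : Set (EuclideanSpace ℝ (Fin k))).Nonempty)
    (U : J → ℝ) (hU0 : ∀ α, 0 ≤ U α) (hfin : ∀ ε > (0:ℝ), {α | U α > ε}.Finite)
    {M : ℝ} (hM : 0 < M) :
    Lam R (fun α => M * U α) =ᵐ[volume] Lam R U := by
  obtain ⟨e⟩ : Nonempty (ℕ ≃ J) := nonempty_equiv_of_countable
  rw [lam_eq_blimsup e R hRne, lam_eq_blimsup e R hRne]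
  refine blimsup_thickening_mul_ae_eq volume (fun _ => True) _ hM (fun i => U (e i)) ?_
  rw [← Nat.cofinite_eq_atTop, Metric.tendsto_nhds]
  intro ε hε
  rw [eventually_cofinite]
  refine ((hfin (ε / 2) (by positivity)).preimage e.injective.injOn).subset ?_
  intro i hi
  simp only [mem_ofPred_eq, not_lt, Real.dist_eq, sub_zero, mem_preimage] at hi ⊢
  rw [abs_of_nonneg (hU0 _)] at hi
  linarith

lemma haus_haar {k : ℕ} : (μH[(k : ℝ)] : Measure (EuclideanSpace ℝ (Fin k))).IsAddHaarMeasure := by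
  simpa using MeasureTheory.isAddHaarMeasure_hausdorffMeasure (E := EuclideanSpace ℝ (Fin k))

lemma ae_of_ball {k : ℕ} {J : Type*} [Countable J]
    (R : J → AffineSubspace ℝ (EuclideanSpace ℝ (Fin k))) (U : J → ℝ)
    (z : EuclideanSpace ℝ (Fin k)) (ρ : ℝ)
    (H : μH[(k : ℝ)] (Metric.ball z ρ ∩ Lam R U) = μH[(k : ℝ)] (Metric.ball z ρ)) :
    ∀ᵐ x ∂(volume : Measure (EuclideanSpace ℝ (Fin k))), x ∈ Metric.ball z ρ → x ∈ Lam R U := by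
  have := haus_haar (k := k)
  have hac : (volume : Measure (EuclideanSpace ℝ (Fin k))) ≪ μH[(k : ℝ)] :=
    Measure.absolutelyContinuous_isAddHaarMeasure _ _
  suffices hs : ∀ᵐ x ∂(μH[(k : ℝ)] : Measure (EuclideanSpace ℝ (Fin k))),
      x ∈ Metric.ball z ρ → x ∈ Lam R U from hac.ae_le hs
  have h := measure_inter_add_sdiff (μ := μH[(k : ℝ)]) (Metric.ball z ρ) (lam_measurable R U)
  rw [H] at h
  have hfin : μH[(k : ℝ)] (Metric.ball z ρ) ≠ ∞ := measure_ball_lt_top.ne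
  have h0 : μH[(k : ℝ)] (Metric.ball z ρ \ Lam R U) = 0 := by
    have : μH[(k : ℝ)] (Metric.ball z ρ) + μH[(k : ℝ)] (Metric.ball z ρ \ Lam R U) =
      μH[(k : ℝ)] (Metric.ball z ρ) + 0 := by simpa using h
    exact (ENNReal.add_right_inj hfin).1 this
  rw [ae_iff]
  convert h0 using 2
  ext x; simp

lemma dimfun_zero {g : ℝ → ℝ} (hg : IsDimFun g) : g 0 = 0 := by
  have h1 : Tendsto g (nhdsWithin 0 (Ioi 0)) (nhds (g 0)) :=
    (hg.1 0 (by simp)).mono_left (nhdsWithin_mono _ Ioi_subset_Ici_self)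
  exact tendsto_nhds_unique h1 hg.2.2.2

lemma dimfun_small {g : ℝ → ℝ} (hg : IsDimFun g) {ε : ℝ} (hε : 0 < ε) :
    ∃ δ > 0, ∀ s, 0 ≤ s → s ≤ δ → g s ≤ ε := by
  have h1 := hg.2.2.2.eventually (gt_mem_nhds hε)
  obtain ⟨δ, hδ, hs⟩ := (mem_nhdsGT_iff_exists_Ioc_subset).1 h1
  refine ⟨δ, hδ, fun s h0 h => ?_⟩
  rcases h0.eq_or_lt with rfl | h0
  · rw [dimfun_zero hg]; exact hε.le
  · exact le_of_lt (hs ⟨h0, h⟩)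

lemma gU_fin {J : Type*} {m : ℕ} (hm : 0 < m) (Υ : J → ℝ) (hΥ0 : ∀ α, 0 ≤ Υ α)
    (hΥfin : ∀ ε > (0:ℝ), {α | Υ α > ε}.Finite) (g : ℝ → ℝ) (hg : IsDimFun g) :
    ∀ ε > (0:ℝ), {α | (g (Υ α)) ^ ((1:ℝ) / m) > ε}.Finite := by
  intro ε hε
  obtain ⟨δ, hδ, h⟩ := dimfun_small hg (pow_pos hε m)
  refine (hΥfin δ hδ).subset fun α hα => ?_
  by_contra hcon
  simp only [mem_ofPred_eq, not_lt, gt_iff_lt] at hα hcon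
  have h1 := h _ (hΥ0 α) hcon
  have h2 : (g (Υ α)) ^ ((1:ℝ) / m) ≤ ε := by
    calc (g (Υ α)) ^ ((1:ℝ) / m) ≤ (ε ^ m) ^ ((1:ℝ) / m) :=
          Real.rpow_le_rpow (hg.2.2.1 _ (hΥ0 α)) h1 (by positivity)
      _ = ε := by rw [one_div]; exact Real.pow_rpow_inv_natCast hε.le hm.ne'
  linarith

lemma bounded_case {k l m : ℕ} (hm : 0 < m) (hk : k = m + l)
    {J : Type*} [Countable J] [Infinite J]
    (R : J → AffineSubspace ℝ (EuclideanSpace ℝ (Fin k)))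
    (hRne : ∀ α, (R α : Set (EuclideanSpace ℝ (Fin k))).Nonempty)
    (Υ : J → ℝ) (hΥ0 : ∀ α, 0 ≤ Υ α)
    (hΥfin : ∀ ε > (0:ℝ), {α | Υ α > ε}.Finite)
    (f g : ℝ → ℝ) (hf : IsDimFun f) (hg : IsDimFun g)
    (hgdef : ∀ r > (0:ℝ), g r = f r / r ^ l)
    (z : EuclideanSpace ℝ (Fin k)) (ρ : ℝ)
    (hae : ∀ᵐ x ∂(volume : Measure (EuclideanSpace ℝ (Fin k))),
      x ∈ Metric.ball z ρ → x ∈ Lam R (fun α => (g (Υ α)) ^ ((1:ℝ) / m)))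
    (C s0 : ℝ) (hC : 0 < C) (hs0 : 0 < s0) (hbd : ∀ s, 0 < s → s ≤ s0 → f s ≤ C * s ^ k)
    (B : Set (EuclideanSpace ℝ (Fin k))) (hB : B ⊆ Metric.ball z ρ) :
    hMeasure f (B ∩ Lam R Υ) = hMeasure f B := by
  have := haus_haar (k := k)
  have hk0 : 0 < k := by omega
  have hle : (hMeasure f : Measure (EuclideanSpace ℝ (Fin k))) ≤ ENNReal.ofReal C • μH[(k : ℝ)] := by
    unfold hMeasure Measure.hausdorffMeasure
    refine Measure.mkMetric_mono_smul ENNReal.ofReal_ne_top (by simpa using hC) ?_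
    have : Iic (ENNReal.ofReal s0) ∈ nhdsWithin (0 : ℝ≥0∞) (Ici 0) :=
      mem_nhdsWithin_of_mem_nhds (Iic_mem_nhds (by simpa using hs0))
    filter_upwards [this] with d hd
    have hdt : d ≠ ∞ := (lt_of_le_of_lt hd ENNReal.ofReal_lt_top).ne
    lift d to NNReal using hdt
    simp only [Pi.smul_apply, smul_eq_mul, ENNReal.coe_toReal]
    rcases eq_or_ne d 0 with rfl | hd0
    · simp [dimfun_zero hf]
    · have hdp : (0 : ℝ) < d := by positivity
      have hds : (d : ℝ) ≤ s0 := by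
        have := ENNReal.toReal_mono ENNReal.ofReal_ne_top hd
        rwa [ENNReal.toReal_ofReal hs0.le] at this
      calc ENNReal.ofReal (f d) ≤ ENNReal.ofReal (C * (d : ℝ) ^ k) :=
            ENNReal.ofReal_le_ofReal (hbd _ hdp hds)
        _ = _ := by
          rw [ENNReal.ofReal_mul hC.le, ENNReal.ofReal_pow hdp.le, ENNReal.ofReal_coe_nnreal,
            ENNReal.rpow_natCast]
  have hac : (hMeasure f : Measure (EuclideanSpace ℝ (Fin k))) ≪ volume :=
    (Measure.absolutelyContinuous_of_le_smul hle).trans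
      (Measure.absolutelyContinuous_isAddHaarMeasure _ _)
  have hsub : Lam R (fun α => (g (Υ α)) ^ ((1:ℝ) / m)) ⊆
      Lam R (fun α => C ^ ((1:ℝ) / m) * Υ α) := by
    intro x hx
    refine (Set.Infinite.sdiff hx (hΥfin s0 hs0)).mono ?_
    rintro α ⟨⟨h1, h2⟩, h3⟩
    simp only [mem_ofPred_eq, not_lt, gt_iff_lt] at h1 h2 h3
    have hne : Υ α ≠ 0 := by
      intro h
      rw [h, dimfun_zero hg, Real.zero_rpow (by positivity)] at h1
      exact lt_irrefl _ h1
    have hp : 0 < Υ α := lt_of_le_of_ne (hΥ0 α) hne.symm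
    have h4 : g (Υ α) ≤ C * Υ α ^ m := by
      rw [hgdef _ hp, div_le_iff₀ (by positivity), mul_assoc, ← pow_add, ← hk]
      exact hbd _ hp h3
    have h5 : (g (Υ α)) ^ ((1:ℝ) / m) ≤ C ^ ((1:ℝ) / m) * Υ α := by
      calc (g (Υ α)) ^ ((1:ℝ) / m) ≤ (C * Υ α ^ m) ^ ((1:ℝ) / m) :=
            Real.rpow_le_rpow (hg.2.2.1 _ (hΥ0 α)) h4 (by positivity)
        _ = _ := by
          rw [Real.mul_rpow hC.le (by positivity)]
          congr 1
          rw [one_div]; exact Real.pow_rpow_inv_natCast hp.le hm.ne'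
    exact ⟨by positivity, h2.trans_le h5⟩
  have hC' : 0 < C ^ ((1:ℝ) / m) := by positivity
  have hnull : ∀ᵐ x ∂(volume : Measure (EuclideanSpace ℝ (Fin k))), x ∈ B → x ∈ Lam R Υ := by
    filter_upwards [hae, (lam_mul_ae R hRne Υ hΥ0 hΥfin hC').mem_iff] with x h1 h2 hx
    exact h2.1 (hsub (h1 (hB hx)))
  apply measure_congr
  have := hac.ae_le hnull
  filter_upwards [this] with x hx
  apply propext
  exact ⟨fun h => h.1, fun h => ⟨h, hx h⟩⟩

lemma loc_lemma {k l m : ℕ} (hm : 0 < m) (hk : k = m + l)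
    {J : Type*} [Countable J] [Infinite J]
    (R : J → AffineSubspace ℝ (EuclideanSpace ℝ (Fin k)))
    (hRne : ∀ α, (R α : Set (EuclideanSpace ℝ (Fin k))).Nonempty)
    (hRdim : ∀ α, Module.finrank ℝ (R α).direction = l)
    (Υ : J → ℝ) (hΥ0 : ∀ α, 0 ≤ Υ α)
    (hΥfin : ∀ ε > (0:ℝ), {α | Υ α > ε}.Finite)
    (f g : ℝ → ℝ) (hf : IsDimFun f) (hg : IsDimFun g)
    (hanti : AntitoneOn (fun r => f r / r ^ k) (Set.Ioi 0))
    (hgdef : ∀ r > (0:ℝ), g r = f r / r ^ l)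
    (z : EuclideanSpace ℝ (Fin k)) (ρ : ℝ)
    (hae : ∀ᵐ x ∂(volume : Measure (EuclideanSpace ℝ (Fin k))),
      x ∈ Metric.ball z ρ → x ∈ Lam R (fun α => (g (Υ α)) ^ ((1:ℝ) / m)))
    (hunb : ∀ M : ℝ, ∃ s0 > 0, ∀ s, 0 < s → s ≤ s0 → M * s ^ k ≤ f s)
    (D : ℝ) (hD : 0 < D) (F : Finset J) (W : Set (EuclideanSpace ℝ (Fin k)))
    (hW : W ⊆ Metric.ball z ρ) :
    ∃ p0, ∀ p ≥ p0, ∀ w, dcube p w ⊆ W →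
      ∃ (ν : Measure (EuclideanSpace ℝ (Fin k))) (L : Set (EuclideanSpace ℝ (Fin k))) (D' : ℝ≥0∞),
        IsCompact L ∧ L ⊆ dcube p w ∧
        L ⊆ {x | ∃ α ∉ F, 0 < Υ α ∧
          Metric.infDist x (R α : Set (EuclideanSpace ℝ (Fin k))) < Υ α} ∧
        ν Lᶜ = 0 ∧ D' ≠ ∞ ∧ (∀ A, ν A ≤ D' * volume A) ∧
        ENNReal.ofReal (D * ((1 / 2 : ℝ) ^ p) ^ k) ≤ ν univ ∧
        ∀ n ≥ p, ∀ z', ν (dcube n z') ≤ ENNReal.ofReal (f ((1 / 2) ^ n)) := by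
  have hk0 : 0 < k := by omega
  have hkr : (0 : ℝ) < k := by exact_mod_cast hk0
  set c0 : ℝ := (2 * k : ℝ) ^ k * k ^ k * 60 ^ k * 2 with hc0
  have hc0p : 0 < c0 := by positivity
  set D1 : ℝ := D * c0 with hD1
  have hD1p : 0 < D1 := by positivity
  have hD1e : c0⁻¹ * D1 = D := by rw [hD1]; field_simp
  set b : ℝ := (D1⁻¹) ^ ((1:ℝ) / m) with hb
  have hbp : 0 < b := by positivity
  have hbm : b ^ m = D1⁻¹ := by
    rw [hb, one_div]; exact Real.rpow_inv_natCast_pow (by positivity) hm.ne'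
  set U : J → ℝ := fun α => (g (Υ α)) ^ ((1:ℝ) / m) with hU
  have hg0 : ∀ α, 0 ≤ g (Υ α) := fun α => hg.2.2.1 _ (hΥ0 α)
  have hU0 : ∀ α, 0 ≤ U α := fun α => Real.rpow_nonneg (hg0 α) _
  have hUm : ∀ α, U α ^ m = g (Υ α) := fun α => by
    simp only [hU]
    rw [one_div]; exact Real.rpow_inv_natCast_pow (hg0 α) hm.ne'
  have hUfin := gU_fin hm Υ hΥ0 hΥfin g hg
  set r : J → ℝ := fun α => b * U α with hr
  have hrm : ∀ α, r α ^ m * D1 = g (Υ α) := fun α => by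
    simp only [hr]
    rw [mul_pow, hbm, hUm]; field_simp
  have hrpos : ∀ α, 0 < r α → 0 < Υ α := by
    intro α h
    refine lt_of_le_of_ne (hΥ0 α) fun h0 => ?_
    have h1 := hrm α
    rw [← h0, dimfun_zero hg] at h1
    have : 0 < r α ^ m * D1 := by positivity
    linarith
  have hrfin : ∀ ε > 0, {α | r α > ε}.Finite := by
    intro ε hε
    refine (hUfin (ε / b) (by positivity)).subset fun α hα => ?_
    simp only [mem_ofPred_eq, gt_iff_lt, hr] at hα ⊢
    rw [div_lt_iff₀ hbp, mul_comm]; exact hα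
  obtain ⟨s1, hs1, hfs1⟩ := hunb D1
  obtain ⟨s2, hs2, hfs2⟩ := hunb ((6 * k : ℝ) ^ k * D1)
  let G : Set J := {α | α ∉ F ∧ (0 < r α → Υ α ≤ r α)}
  have hG : Gᶜ.Finite := by
    refine (F.finite_toSet.union (hΥfin s1 hs1)).subset fun α hα => ?_
    by_contra hcon
    simp only [mem_union, not_or, mem_ofPred_eq, not_lt, Finset.mem_coe, gt_iff_lt] at hcon
    apply hα
    refine ⟨hcon.1, fun h => ?_⟩
    have hp := hrpos α h
    have h1 := hfs1 _ hp hcon.2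
    have h2 : D1 * Υ α ^ m ≤ g (Υ α) := by
      rw [hgdef _ hp, le_div_iff₀ (by positivity), mul_assoc, ← pow_add, ← hk]
      exact h1
    rw [← hrm α, mul_comm] at h2
    have h3 := le_of_mul_le_mul_right h2 hD1p
    exact le_of_pow_le_pow_left₀ hm.ne' h.le h3
  have haer : ∀ᵐ x ∂(volume : Measure (EuclideanSpace ℝ (Fin k))),
      x ∈ Metric.ball z ρ → x ∈ Lam R r := by
    filter_upwards [hae, (lam_mul_ae R hRne U hU0 hUfin hbp).mem_iff] with x h1 h2 hx
    exact h2.2 (h1 hx)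
  obtain ⟨p0, hp0⟩ := exists_pow_lt_of_lt_one hs2 (show (1 / 2 : ℝ) < 1 by norm_num)
  refine ⟨p0, fun p hp w hw => ?_⟩
  have hps : (1 / 2 : ℝ) ^ p ≤ s2 :=
    (pow_le_pow_of_le_one (by norm_num) (by norm_num) hp).trans hp0.le
  have hpp : (0 : ℝ) < (1 / 2) ^ p := by positivity
  obtain ⟨c, hc⟩ := ball_subset_dcube p w
  obtain ⟨ν, K, D', h1, h2, h3, h4, h5, h6, h7, h8⟩ :=
    local_measure hm hk R hRne hRdim Υ f g hf.2.2.1 hg.2.1 hanti hgdef D1 hD1p r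
      (fun α h => ⟨hrpos α h, hrm α⟩) hrfin G hG (fun α h => h.2) c ((1 / 2 : ℝ) ^ p) hpp
      (by
        filter_upwards [haer] with x hx hxc
        refine hx (hW (hw (hc (Metric.ball_subset_ball ?_ hxc))))
        linarith)
      (fun s hs hss => hfs2 s hs (hss.trans hps))
  refine ⟨ν, K, D', h1, h2.trans hc, ?_, h4, h5, h6, ?_, ?_⟩
  · intro x hx
    obtain ⟨α, hα, h⟩ := h3 x hx
    exact ⟨α, hα.1, h⟩
  · rw [← hD1e]; exact h7
  · intro n hn z'
    refine h8 _ _ (by positivity) (pow_le_pow_of_le_one (by norm_num) (by norm_num) hn) ?_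
    intro a ha a' ha'
    exact dcube_dist ha ha'

lemma unbounded_case {k l m : ℕ} (hm : 0 < m) (hk : k = m + l)
    {J : Type*} [Countable J] [Infinite J]
    (R : J → AffineSubspace ℝ (EuclideanSpace ℝ (Fin k)))
    (hRne : ∀ α, (R α : Set (EuclideanSpace ℝ (Fin k))).Nonempty)
    (hRdim : ∀ α, Module.finrank ℝ (R α).direction = l)
    (Υ : J → ℝ) (hΥ0 : ∀ α, 0 ≤ Υ α)
    (hΥfin : ∀ ε > (0:ℝ), {α | Υ α > ε}.Finite)
    (f g : ℝ → ℝ) (hf : IsDimFun f) (hg : IsDimFun g)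
    (hanti : AntitoneOn (fun r => f r / r ^ k) (Set.Ioi 0))
    (hgdef : ∀ r > (0:ℝ), g r = f r / r ^ l)
    (z : EuclideanSpace ℝ (Fin k)) (ρ : ℝ)
    (hae : ∀ᵐ x ∂(volume : Measure (EuclideanSpace ℝ (Fin k))),
      x ∈ Metric.ball z ρ → x ∈ Lam R (fun α => (g (Υ α)) ^ ((1:ℝ) / m)))
    (hunb : ∀ M : ℝ, ∃ s0 > 0, ∀ s, 0 < s → s ≤ s0 → M * s ^ k ≤ f s)
    (x : EuclideanSpace ℝ (Fin k)) (t : ℝ) (ht : 0 < t)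
    (hB : Metric.ball x t ⊆ Metric.ball z ρ) (D : ℝ) (hD : 0 < D) :
    ENNReal.ofReal D * volume (Metric.closedBall x (t / 2)) / 6 ^ k ≤
      hMeasure f (Metric.ball x t ∩ Lam R Υ) := by
  classical
  obtain ⟨s1, hs1, hfs1⟩ := hunb D
  obtain ⟨n0, hn0⟩ := exists_pow_lt_of_lt_one hs1 (show (1 / 2 : ℝ) < 1 by norm_num)
  set v : ℝ≥0∞ := ENNReal.ofReal D * volume (Metric.closedBall x (t / 2)) with hv
  obtain ⟨F, hF⟩ := exists_surjective_nat (Finset J)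
  let O : ℕ → Set (EuclideanSpace ℝ (Fin k)) := fun n => {y | ∃ α ∉ F n, 0 < Υ α ∧
          Metric.infDist y (R α : Set (EuclideanSpace ℝ (Fin k))) < Υ α}
  let P : Measure (EuclideanSpace ℝ (Fin k)) × Set (EuclideanSpace ℝ (Fin k)) → Prop := fun q =>
    IsOpen q.2 ∧ q.2 ⊆ Metric.ball x t ∧ (∃ (D : ℝ) (K : Set (EuclideanSpace ℝ (Fin k))), 0 < D ∧
      (∀ A, q.1 A ≤ ENNReal.ofReal D * volume A) ∧ IsCompact K ∧ K ⊆ q.2 ∧ q.1 Kᶜ = 0) ∧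
      q.1 univ = v ∧ ∀ n ≥ n0, ∀ w, q.1 (dcube n w) ≤ ENNReal.ofReal (f ((1 / 2) ^ n))
  have step : ∀ (n : ℕ) (q : {q // P q}), ∃ q' : {q // P q},
      IsCompact (closure q'.1.2) ∧ closure q'.1.2 ⊆ q.1.2 ∩ O n := by
    rintro n ⟨⟨μ, W⟩, hWo, hWB, ⟨E, K, hE, hμE, hK, hKW, hμK⟩, hμv, hμf⟩
    simp only at hWo hWB hμE hKW hμK hμv hμf
    obtain ⟨μ', E', K', hE', hμE', hK', hK'W, hK'O, hμK', hμv', hμf'⟩ :=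
      step_lemma f n0 μ E hE hμE K W (O n) hK hWo hKW hμK hμf
        (loc_lemma hm hk R hRne hRdim Υ hΥ0 hΥfin f g hf hg hanti hgdef z ρ hae hunb E hE (F n) W
          (hWB.trans hB))
    obtain ⟨W', hW'o, hKW', hW's, hW'c⟩ := exists_open_between_and_isCompact_closure hK'
      (hWo.inter (nbhd_open R Υ (F n))) (subset_inter hK'W hK'O)
    exact ⟨⟨(μ', W'), hW'o, subset_closure.trans (hW's.trans (inter_subset_left.trans hWB)),
      ⟨E', K', hE', hμE', hK', hKW', hμK'⟩, hμv'.trans hμv, hμf'⟩, hW'c, hW's⟩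
  choose nxt hnxt1 hnxt2 using step
  have hbase : P ((ENNReal.ofReal D • volume.restrict (Metric.closedBall x (t / 2)),
      Metric.ball x t)) := by
    refine ⟨Metric.isOpen_ball, Subset.rfl, ⟨D, Metric.closedBall x (t / 2), hD, ?_,
      isCompact_closedBall _ _, Metric.closedBall_subset_ball (by linarith), ?_⟩, ?_, ?_⟩
    · intro A
      simp only [Measure.smul_apply, smul_eq_mul]
      gcongr
      exact Measure.restrict_le_self
    · simp only [Measure.smul_apply, smul_eq_mul]
      rw [Measure.restrict_apply Metric.isClosed_closedBall.measurableSet.compl]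
      simp
    · simp [hv]
    · intro n hn w
      simp only [Measure.smul_apply, smul_eq_mul]
      calc ENNReal.ofReal D * volume.restrict (Metric.closedBall x (t / 2)) (dcube n w)
          ≤ ENNReal.ofReal D * ENNReal.ofReal (((1 / 2 : ℝ) ^ n) ^ k) := by
            gcongr
            exact (Measure.restrict_apply_le _ _).trans (dcube_volume_le n w)
        _ = ENNReal.ofReal (D * ((1 / 2 : ℝ) ^ n) ^ k) := (ENNReal.ofReal_mul hD.le).symm
        _ ≤ _ := ENNReal.ofReal_le_ofReal (hfs1 _ (by positivity)
            ((pow_le_pow_of_le_one (by norm_num) (by norm_num) hn).trans hn0.le))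
  let sq : ℕ → {q // P q} := fun n => Nat.rec ⟨_, hbase⟩ (fun n q => nxt n q) n
  have hsq : ∀ n, sq (n + 1) = nxt n (sq n) := fun n => rfl
  have hc1 : ∀ n, IsCompact (closure (sq (n + 1)).1.2) := fun n => by
    rw [hsq]; exact hnxt1 _ _
  have hc2 : ∀ n, closure (sq (n + 1)).1.2 ⊆ (sq n).1.2 ∩ O n := fun n => by
    rw [hsq]; exact hnxt2 _ _
  have hanC : Antitone fun n => closure (sq (n + 1)).1.2 :=
    antitone_nat_of_succ_le fun n => (hc2 (n + 1)).trans (inter_subset_left.trans subset_closure)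
  have hlow := hMeasure_lower f hf.1 hf.2.2.1 hf.2.1 hanti n0 v (fun n => (sq (n + 1)).1.1)
    (fun j => (sq (j + 1)).2.2.2.2.2) (fun j => (sq (j + 1)).2.2.2.2.1)
    (fun n => closure (sq (n + 1)).1.2) hc1 hanC (by
      intro j
      obtain ⟨E, K, -, -, -, hKW, hμK⟩ := (sq (j + 1)).2.2.2.1
      exact measure_mono_null (compl_subset_compl.2 (hKW.trans subset_closure)) hμK)
  refine hlow.trans (measure_mono ?_)
  intro y hy
  rw [mem_iInter] at hy
  refine ⟨(sq 0).2.2.1 (hc2 0 (hy 0)).1, ?_⟩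
  rw [lam_iff]
  intro S
  obtain ⟨n, rfl⟩ := hF S
  exact (hc2 n (hy n)).2

/-- The Mass Transference Principle for systems of linear forms (Theorem 3). -/
theorem stmt14 {k l m : ℕ} (hm : 0 < m) (hk : k = m + l)
    {J : Type*} [Countable J] [Infinite J]
    (R : J → AffineSubspace ℝ (EuclideanSpace ℝ (Fin k)))
    (hRne : ∀ α, (R α : Set (EuclideanSpace ℝ (Fin k))).Nonempty)
    (hRdim : ∀ α, Module.finrank ℝ (R α).direction = l)
    (Υ : J → ℝ) (hΥ0 : ∀ α, 0 ≤ Υ α)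
    (hΥfin : ∀ ε > (0:ℝ), {α | Υ α > ε}.Finite)
    (V : Submodule ℝ (EuclideanSpace ℝ (Fin k)))
    (hVdim : Module.finrank ℝ V = m)
    (hi : ∀ α, ((V : Set (EuclideanSpace ℝ (Fin k))) ∩ (R α : Set (EuclideanSpace ℝ (Fin k)))).Nonempty)
    (hii : ∃ C : ℝ, ∀ α, Metric.diam ((V : Set (EuclideanSpace ℝ (Fin k))) ∩
      {x | Metric.infDist x (R α : Set (EuclideanSpace ℝ (Fin k))) < 1}) ≤ C)
    (f g : ℝ → ℝ) (hf : IsDimFun f) (hg : IsDimFun g)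
    (hmono : MonotoneOn (fun r => f r / r ^ k) (Set.Ioi 0) ∨
      AntitoneOn (fun r => f r / r ^ k) (Set.Ioi 0))
    (hgdef : ∀ r > (0:ℝ), g r = f r / r ^ l)
    (z : EuclideanSpace ℝ (Fin k)) (ρ : ℝ) (hρ : 0 < ρ)
    (H : ∀ (x : EuclideanSpace ℝ (Fin k)) (t : ℝ), 0 < t →
      Metric.ball x t ⊆ Metric.ball z ρ →
      μH[(k : ℝ)] (Metric.ball x t ∩ Lam R (fun α => (g (Υ α)) ^ ((1:ℝ) / m))) =
        μH[(k : ℝ)] (Metric.ball x t)) :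
    ∀ (x : EuclideanSpace ℝ (Fin k)) (t : ℝ), 0 < t →
      Metric.ball x t ⊆ Metric.ball z ρ →
      hMeasure f (Metric.ball x t ∩ Lam R Υ) = hMeasure f (Metric.ball x t) := by
  have hae := ae_of_ball R _ z ρ (H z ρ hρ Subset.rfl)
  intro x t ht hB
  by_cases hbd : ∃ C > 0, ∃ s0 > 0, ∀ s, 0 < s → s ≤ s0 → f s ≤ C * s ^ k
  · obtain ⟨C, hC, s0, hs0, hbd⟩ := hbd
    exact bounded_case hm hk R hRne Υ hΥ0 hΥfin f g hf hg hgdef z ρ hae C s0 hC hs0 hbd _ hB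
  · push Not at hbd
    have hanti : AntitoneOn (fun r => f r / r ^ k) (Set.Ioi 0) := by
      rcases hmono with h | h
      · exfalso
        obtain ⟨s, hs, hs1, hlt⟩ := hbd (max (f 1) 1) (by positivity) 1 one_pos
        have h1 := h (mem_Ioi.2 hs) (mem_Ioi.2 one_pos) hs1
        simp only [one_pow, div_one] at h1
        rw [div_le_iff₀ (by positivity)] at h1
        have h2 : f 1 * s ^ k ≤ max (f 1) 1 * s ^ k :=
          mul_le_mul_of_nonneg_right (le_max_left _ _) (by positivity)
        linarith
      · exact h
    have hunb : ∀ M : ℝ, ∃ s0 > 0, ∀ s, 0 < s → s ≤ s0 → M * s ^ k ≤ f s := by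
      intro M
      obtain ⟨s, hs, hs1, hlt⟩ := hbd (max M 1) (by positivity) 1 one_pos
      refine ⟨s, hs, fun s' hs' hle => ?_⟩
      have h1 := hanti (mem_Ioi.2 hs') (mem_Ioi.2 hs) hle
      simp only at h1
      have h2 : max M 1 ≤ f s / s ^ k := (le_div_iff₀ (by positivity)).2 hlt.le
      exact (le_div_iff₀ (by positivity)).1 ((le_max_left M 1).trans (h2.trans h1))
    have hinf : hMeasure f (Metric.ball x t ∩ Lam R Υ) = ∞ := by
      by_contra hne
      set T := hMeasure f (Metric.ball x t ∩ Lam R Υ) with hT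
      set b := volume (Metric.closedBall x (t / 2)) with hb
      have hbpos : b ≠ 0 := (Metric.measure_closedBall_pos volume x (by positivity)).ne'
      have hbfin : b ≠ ∞ := measure_closedBall_lt_top.ne
      have h6 : (6 : ℝ≥0∞) ^ k ≠ 0 := by positivity
      have h6' : (6 : ℝ≥0∞) ^ k ≠ ∞ := ENNReal.pow_ne_top (by norm_num)
      have hq : T * 6 ^ k / b ≠ ∞ := ENNReal.div_ne_top (ENNReal.mul_ne_top hne h6') hbpos
      have h := unbounded_case hm hk R hRne hRdim Υ hΥ0 hΥfin f g hf hg hanti hgdef z ρ hae hunb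
        x t ht hB ((T * 6 ^ k / b).toReal + 1) (by positivity)
      rw [ENNReal.div_le_iff h6 h6', ← ENNReal.le_div_iff_mul_le (Or.inl hbpos) (Or.inl hbfin)] at h
      have h' := ENNReal.toReal_mono hq h
      rw [ENNReal.toReal_ofReal (by positivity)] at h'
      linarith
    refine le_antisymm (measure_mono inter_subset_left) ?_
    rw [hinf]
    exact le_top
end

section
/- Let ψ : ℝ⁺ → ℝ⁺ be a monotonic function with ψ(h) → 0 as h → ∞. Let f be a dimension function such that g(r) := r^{-1} f(r) is a dimension function. If Σ_{h=1}^∞ g(ψ(h)/h²) · h² < ∞, then H^f(S₂(ψ)) = 0, where S₂(ψ) := {x ∈ [0,1)² : |a²·x − p²| < ψ(|a|) for infinitely many (a,p) ∈ ℤ² × ℤ}. -/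
open MeasureTheory Set Filter
open scoped ENNReal

/-- The set `S₂(ψ)` of `x ∈ [0,1)²` with `|a² · x - p²| < ψ(|a|)` for infinitely
many `(a, p) ∈ ℤ² × ℤ`. -/
def S2 (ψ : ℝ → ℝ) : Set (EuclideanSpace ℝ (Fin 2)) :=
  {x | (∀ i, x i ∈ Set.Ico (0:ℝ) 1) ∧
    {q : (Fin 2 → ℤ) × ℤ |
      |(q.1 0 : ℝ) ^ 2 * x 0 + (q.1 1 : ℝ) ^ 2 * x 1 - (q.2 : ℝ) ^ 2| <
        ψ ((max (q.1 0).natAbs (q.1 1).natAbs : ℕ) : ℝ)}.Infinite}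

/-- The unit box `[0,1)²`. -/
def box2 : Set (EuclideanSpace ℝ (Fin 2)) := {x | ∀ i, x i ∈ Set.Ico (0:ℝ) 1}

lemma s2aux_diam (c : Fin 2) (α β δ : ℝ) (hδ : 0 ≤ δ) :
    Metric.ediam {x : EuclideanSpace ℝ (Fin 2) | x (c + 1) ∈ Icc α (α + δ) ∧ x c ∈ Icc β (β + δ)}
      ≤ ENNReal.ofReal (4 * δ) := by
  refine Metric.ediam_le ?_
  rintro x ⟨⟨h1, h2⟩, h3, h4⟩ y ⟨⟨h5, h6⟩, h7, h8⟩
  rw [edist_dist]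
  apply ENNReal.ofReal_le_ofReal
  rw [EuclideanSpace.dist_eq]
  apply Real.sqrt_le_iff.2
  refine ⟨by linarith, ?_⟩
  have e : ∑ i, dist (x i) (y i) ^ 2 = (x (c+1) - y (c+1)) ^ 2 + (x c - y c) ^ 2 := by
    fin_cases c <;> simp [Fin.sum_univ_two, Real.dist_eq, sq_abs] <;> ring
  rw [e]
  have a1 : (x (c+1) - y (c+1)) ^ 2 ≤ δ ^ 2 := sq_le_sq' (by linarith) (by linarith)
  have a2 : (x c - y c) ^ 2 ≤ δ ^ 2 := sq_le_sq' (by linarith) (by linarith)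
  nlinarith [sq_nonneg δ]

/-- the points of the box close to some resonant line of height `h` -/
def S2aux (h : ℕ) (s : ℝ) : Set (EuclideanSpace ℝ (Fin 2)) :=
  {x | (∀ i, x i ∈ Set.Ico (0:ℝ) 1) ∧ ∃ (c : Fin 2) (m p : ℕ), m ≤ h ∧
    |(h : ℝ) ^ 2 * x c + (m : ℝ) ^ 2 * x (c + 1) - (p : ℝ) ^ 2| < s}

lemma s2aux_cover (f g : ℝ → ℝ) (hf : IsDimFun f) (hg : IsDimFun g)
    (hgdef : ∀ r > (0:ℝ), g r = f r / r) (h : ℕ) (hh : 1 ≤ h) (s : ℝ) (hs0 : 0 ≤ s) (hs1 : s ≤ 1) :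
    ∃ (N : ℕ) (t : Fin N → Set (EuclideanSpace ℝ (Fin 2))),
      (∀ i, Metric.ediam (t i) ≤ ENNReal.ofReal (s / (h : ℝ) ^ 2)) ∧
      S2aux h s ⊆ ⋃ i, t i ∧
      (N : ℝ) * f (s / (h : ℝ) ^ 2) ≤ 960 * (g (s / (h : ℝ) ^ 2) * (h : ℝ) ^ 2) := by
  have hh' : (1:ℝ) ≤ h := by exact_mod_cast hh
  rcases hs0.eq_or_lt with rfl | hs
  · refine ⟨0, fun _ => ∅, by simp, ?_, ?_⟩
    · rintro x ⟨-, c, m, p, -, hx⟩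
      exact absurd hx (not_lt.2 (abs_nonneg _))
    · have := hg.2.2.1 (0 / (h:ℝ)^2) (by positivity)
      push_cast
      rw [zero_mul]; positivity
  set r : ℝ := s / (h : ℝ) ^ 2 with hr
  have hr0 : 0 < r := by positivity
  have hsr : s = r * (h:ℝ)^2 := by rw [hr]; field_simp
  have hr1 : r ≤ 1 := by
    rw [hr, div_le_one (by positivity)]; nlinarith
  let U : ℕ := ⌊4 / r⌋₊ + 1
  let ι := Fin 2 × Fin (h + 1) × Fin (2 * h + 1) × Fin U × Fin 16
  let T : ι → Set (EuclideanSpace ℝ (Fin 2)) := fun q =>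
    let α : ℝ := (q.2.2.2.1 : ℕ) * (r / 4)
    let β : ℝ := ((q.2.2.1 : ℕ) / (h:ℝ)) ^ 2 - ((q.2.1 : ℕ) / (h:ℝ)) ^ 2 * α
      + (((q.2.2.2.2 : ℕ) : ℝ) - 8) * (r / 4)
    {x | x (q.1 + 1) ∈ Icc α (α + r / 4) ∧ x q.1 ∈ Icc β (β + r / 4)}
  refine ⟨Fintype.card ι, fun i => T ((Fintype.equivFin ι).symm i), ?_, ?_, ?_⟩
  · intro i
    refine (s2aux_diam _ _ _ (r / 4) (by positivity)).trans (le_of_eq ?_)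
    congr 1; ring
  · rintro x ⟨hx, c, m, p, hm, hxs⟩
    have hm' : (m:ℝ) ≤ h := by exact_mod_cast hm
    obtain ⟨hc0, hc1⟩ := hx c
    obtain ⟨hd0, hd1⟩ := hx (c+1)
    obtain ⟨l1, l2⟩ := abs_lt.1 hxs
    have hmm : (m:ℝ)^2 ≤ (h:ℝ)^2 := by gcongr
    have hp : p ≤ 2 * h := by
      by_contra hcon
      have : (2 * h + 1 : ℝ) ≤ p := by exact_mod_cast (not_le.1 hcon)
      nlinarith [mul_le_mul_of_nonneg_left hc1.le (sq_nonneg (h:ℝ)),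
        mul_le_mul hmm hd1.le hd0 (sq_nonneg (h:ℝ))]
    set u : ℕ := ⌊x (c+1) / (r / 4)⌋₊ with hu
    have hu1 : (u:ℝ) * (r/4) ≤ x (c+1) := by
      rw [← le_div_iff₀ (by positivity)]
      exact Nat.floor_le (by positivity)
    have hu2 : x (c+1) < (u + 1:ℝ) * (r/4) := by
      rw [← div_lt_iff₀ (by positivity)]
      exact Nat.lt_floor_add_one _
    have huU : u < U := by
      apply Nat.lt_succ_of_le
      apply Nat.floor_le_floor
      rw [div_div_eq_mul_div]
      gcongr
      linarith
    set κ : ℝ := (m / (h:ℝ))^2 with hκ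
    have hκ0 : 0 ≤ κ := by positivity
    have hκ1 : κ ≤ 1 := by
      rw [hκ, div_pow, div_le_one (by positivity)]; exact hmm
    set y : ℝ := x c - ((p / (h:ℝ))^2 - κ * (u * (r/4))) with hy
    have hz : |x c + κ * x (c+1) - (p / (h:ℝ))^2| < r := by
      have e : (h : ℝ) ^ 2 * x c + (m : ℝ) ^ 2 * x (c + 1) - (p : ℝ) ^ 2
          = (h:ℝ)^2 * (x c + κ * x (c+1) - (p / (h:ℝ))^2) := by
        rw [hκ]; field_simp
      rw [e, abs_mul, abs_of_nonneg (sq_nonneg _), hsr, mul_comm r] at hxs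
      exact lt_of_mul_lt_mul_left hxs (by positivity)
    obtain ⟨z1, z2⟩ := abs_lt.1 hz
    have k1 : κ * (u * (r/4)) ≤ κ * x (c+1) := by gcongr
    have k2 : κ * x (c+1) ≤ κ * (u * (r/4)) + r/4 := by
      nlinarith
    set v : ℕ := ⌊(y + 2 * r) / (r / 4)⌋₊ with hv
    have hv1 : (v:ℝ) * (r/4) ≤ y + 2 * r := by
      rw [← le_div_iff₀ (by positivity)]
      refine Nat.floor_le (div_nonneg ?_ (by positivity))
      rw [hy]; linarith
    have hv2 : y + 2 * r < (v + 1:ℝ) * (r/4) := by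
      rw [← div_lt_iff₀ (by positivity)]
      exact Nat.lt_floor_add_one _
    have hv16 : v < 16 := by
      rw [hv, Nat.floor_lt' (by norm_num), div_lt_iff₀ (by positivity)]
      push_cast
      rw [hy]; linarith
    refine mem_iUnion.2 ⟨Fintype.equivFin ι (c, ⟨m, by omega⟩, ⟨p, by omega⟩, ⟨u, huU⟩, ⟨v, hv16⟩), ?_⟩
    rw [Equiv.symm_apply_apply]
    refine ⟨⟨hu1, ?_⟩, ?_, ?_⟩
    · show x (c+1) ≤ (u:ℝ) * (r/4) + r/4
      linarith
    · show (p / (h:ℝ))^2 - κ * (u * (r/4)) + ((v:ℝ) - 8) * (r/4) ≤ x c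
      rw [hy] at hv1; linarith
    · show x c ≤ (p / (h:ℝ))^2 - κ * (u * (r/4)) + ((v:ℝ) - 8) * (r/4) + r/4
      rw [hy] at hv2; linarith
  · have hU : (U:ℝ) ≤ 5 / r := by
      have : (⌊4 / r⌋₊:ℝ) ≤ 4 / r := Nat.floor_le (by positivity)
      have h1 : 1 ≤ 1 / r := by rw [le_div_iff₀ hr0]; linarith
      have : (U:ℝ) = (⌊4 / r⌋₊:ℝ) + 1 := by simp [U]
      have : 5 / r = 4 / r + 1 / r := by ring
      linarith
    have hcard : (Fintype.card ι : ℝ) = 2 * ((h + 1) * ((2 * h + 1) * (U * 16))) := by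
      simp [ι]
    have hfr := hf.2.2.1 r hr0.le
    rw [hcard, hgdef r hr0]
    calc 2 * (((h:ℝ) + 1) * ((2 * h + 1) * (U * 16))) * f r
        ≤ 2 * (((h:ℝ) + h) * ((2 * h + h) * (5 / r * 16))) * f r := by gcongr
      _ = 960 * (f r / r * (h:ℝ)^2) := by ring

lemma s2aux_infinite (ψ : ℝ → ℝ) (hψ0 : ∀ h, 0 ≤ ψ h) (x : EuclideanSpace ℝ (Fin 2))
    (hx : x ∈ S2 ψ) (n : ℕ) : ∃ h : ℕ, n ≤ h ∧ x ∈ S2aux h (ψ h) := by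
  obtain ⟨hbox, hinf⟩ := hx
  by_contra! hcon
  apply hinf
  let B : ℕ := ⌈2 * (n:ℝ)^2 + ∑ i ∈ Finset.range n, ψ i⌉₊
  have hfin : ((Set.Icc (fun _ => -(n:ℤ)) (fun _ => (n:ℤ)) : Set (Fin 2 → ℤ)) ×ˢ
    (Set.Icc (-(B:ℤ)) B)).Finite := (Set.finite_Icc _ _).prod (Set.finite_Icc _ _)
  refine hfin.subset ?_
  rintro ⟨a, p⟩ hq
  simp only [mem_setOf_eq] at hq
  obtain ⟨H, hH⟩ : ∃ H, H = max (a 0).natAbs (a 1).natAbs := ⟨_, rfl⟩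
  rw [← hH] at hq
  have ca : ∀ i, ((a i : ℝ))^2 = (((a i).natAbs : ℕ):ℝ)^2 := by
    intro i; rw [Nat.cast_natAbs, Int.cast_abs, sq_abs]
  have cp : (p:ℝ)^2 = ((p.natAbs : ℕ):ℝ)^2 := by
    rw [Nat.cast_natAbs, Int.cast_abs, sq_abs]
  rw [ca, ca, cp] at hq
  have hHn : H < n := by
    by_contra hge
    refine hcon H (not_lt.1 hge) ⟨hbox, ?_⟩
    rcases le_total (a 0).natAbs (a 1).natAbs with hle | hle
    · rw [max_eq_right hle] at hH
      refine ⟨1, (a 0).natAbs, p.natAbs, by omega, ?_⟩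
      rw [← hH] at hq
      have : (1:Fin 2) + 1 = 0 := rfl
      rw [this]
      rwa [add_comm ((H:ℝ)^2 * x 1)]
    · rw [max_eq_left hle] at hH
      refine ⟨0, (a 1).natAbs, p.natAbs, by omega, ?_⟩
      rw [← hH] at hq
      exact hq
  have h0 : (a 0).natAbs ≤ n := by omega
  have h1 : (a 1).natAbs ≤ n := by omega
  have hpB : p.natAbs ≤ B := by
    have hψH : ψ H ≤ ∑ i ∈ Finset.range n, ψ i :=
      Finset.single_le_sum (f := fun i : ℕ => ψ i) (fun i _ => hψ0 _) (Finset.mem_range.2 hHn)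
    have h0' : (((a 0).natAbs : ℕ):ℝ)^2 ≤ (n:ℝ)^2 := by gcongr
    have h1' : (((a 1).natAbs : ℕ):ℝ)^2 ≤ (n:ℝ)^2 := by gcongr
    have m0 := mul_le_mul h0' (hbox 0).2.le (hbox 0).1 (sq_nonneg (n:ℝ))
    have m1 := mul_le_mul h1' (hbox 1).2.le (hbox 1).1 (sq_nonneg (n:ℝ))
    have hB : 2 * (n:ℝ)^2 + ∑ i ∈ Finset.range n, ψ i ≤ B := Nat.le_ceil _
    have := (abs_lt.1 hq).1
    have hp2 : ((p.natAbs:ℕ):ℝ)^2 ≤ B := by linarith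
    have hp3 : p.natAbs ^ 2 ≤ B := by exact_mod_cast hp2
    exact (Nat.le_self_pow (by norm_num) _).trans hp3
  refine ⟨⟨?_, ?_⟩, ?_, ?_⟩
  · intro i; fin_cases i <;> simp <;> omega
  · intro i; fin_cases i <;> simp <;> omega
  · show -(B:ℤ) ≤ p
    omega
  · show p ≤ (B:ℤ)
    omega

theorem stmt15 (ψ : ℝ → ℝ) (hψ0 : ∀ h, 0 ≤ ψ h)
    (hmono : MonotoneOn ψ (Set.Ici 0) ∨ AntitoneOn ψ (Set.Ici 0))
    (hlim : Tendsto ψ atTop (nhds 0))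
    (f g : ℝ → ℝ) (hf : IsDimFun f) (hg : IsDimFun g)
    (hgdef : ∀ r > (0:ℝ), g r = f r / r)
    (hconv : ∑' h : ℕ,
      ENNReal.ofReal (g (ψ ((h : ℝ) + 1) / ((h : ℝ) + 1) ^ 2) * ((h : ℝ) + 1) ^ 2) ≠ ⊤) :
    hMeasure f (S2 ψ) = 0 := by
  obtain ⟨n0, hn0⟩ : ∃ n0 : ℕ, ∀ h : ℕ, n0 ≤ h → ψ ((h:ℝ) + 1) ≤ 1 := by
    have h1 : ∀ᶠ y in atTop, ψ y < 1 := hlim.eventually_lt_const one_pos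
    obtain ⟨b, hb⟩ := eventually_atTop.1 h1
    refine ⟨⌈b⌉₊, fun h hh => (hb _ ?_).le⟩
    have : (⌈b⌉₊:ℝ) ≤ h := by exact_mod_cast hh
    linarith [Nat.le_ceil b]
  have hcov : ∀ h : ℕ, ∃ (N : ℕ) (t : Fin N → Set (EuclideanSpace ℝ (Fin 2))), n0 ≤ h →
      (∀ i, Metric.ediam (t i) ≤ ENNReal.ofReal (ψ ((h:ℝ) + 1) / ((h : ℝ) + 1) ^ 2)) ∧
      S2aux (h + 1) (ψ ((h:ℝ) + 1)) ⊆ ⋃ i, t i ∧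
      (N : ℝ) * f (ψ ((h:ℝ) + 1) / ((h : ℝ) + 1) ^ 2)
        ≤ 960 * (g (ψ ((h:ℝ) + 1) / ((h : ℝ) + 1) ^ 2) * ((h : ℝ) + 1) ^ 2) := by
    intro h
    by_cases hh : n0 ≤ h
    · obtain ⟨N, t, ht⟩ := s2aux_cover f g hf hg hgdef (h + 1) (by omega) (ψ ((h:ℝ) + 1))
        (hψ0 _) (hn0 h hh)
      push_cast at ht
      exact ⟨N, t, fun _ => ht⟩
    · exact ⟨0, fun _ => ∅, fun h' => absurd h' hh⟩
  choose N t ht using hcov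
  set F : ℕ → ℝ≥0∞ := fun h =>
    ENNReal.ofReal (g (ψ ((h : ℝ) + 1) / ((h : ℝ) + 1) ^ 2) * ((h : ℝ) + 1) ^ 2) with hF
  have key := Measure.mkMetric_le_liminf_tsum (ι := fun n : ℕ => Σ h : ℕ, Fin (N (h + n)))
    (l := atTop) (S2 ψ) (fun n : ℕ => ENNReal.ofReal (1 / ((n:ℝ) + 1)))
    (by
      have := ENNReal.tendsto_ofReal (tendsto_one_div_add_atTop_nhds_zero_nat (𝕜 := ℝ))
      simpa using this)
    (fun n q => t (q.1 + n) q.2)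
    (by
      filter_upwards [eventually_ge_atTop n0] with n hn q
      refine ((ht (q.1 + n) (by omega)).1 q.2).trans (ENNReal.ofReal_le_ofReal ?_)
      have h1 := hn0 (q.1 + n) (by omega)
      have h2 : (n:ℝ) + 1 ≤ ((q.1 + n : ℕ):ℝ) + 1 := by push_cast; linarith [(Nat.cast_nonneg q.1 : (0:ℝ) ≤ _)]
      have h3 : (1:ℝ) ≤ (n:ℝ) + 1 := by linarith [(Nat.cast_nonneg n : (0:ℝ) ≤ _)]
      apply div_le_div₀ zero_le_one h1 (by linarith)
      nlinarith)
    (by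
      filter_upwards [eventually_ge_atTop n0] with n hn x hx
      obtain ⟨h, hh, hxh⟩ := s2aux_infinite ψ hψ0 x hx (n + 1)
      obtain ⟨k, rfl⟩ : ∃ k, h = (k + n) + 1 := ⟨h - n - 1, by omega⟩
      have := (ht (k + n) (by omega)).2.1
      have hm : x ∈ ⋃ i, t (k + n) i := this (by simpa using hxh)
      obtain ⟨i, hi⟩ := mem_iUnion.1 hm
      exact mem_iUnion.2 ⟨⟨k, i⟩, hi⟩)
    (fun d => ENNReal.ofReal (f d.toReal))
  have htail : Tendsto (fun n => 960 * ∑' k, F (k + n)) atTop (nhds (0:ℝ≥0∞)) := by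
    have := ENNReal.Tendsto.const_mul (a := 960) (ENNReal.tendsto_sum_nat_add F hconv)
      (Or.inr (by norm_num))
    simpa using this
  refine le_antisymm (key.trans ?_) bot_le
  rw [← htail.liminf_eq]
  refine liminf_le_liminf ?_
  filter_upwards [eventually_ge_atTop n0] with n hn
  rw [ENNReal.tsum_sigma', ← ENNReal.tsum_mul_left]
  refine ENNReal.tsum_le_tsum fun k => ?_
  obtain ⟨hd, -, hN⟩ := ht (k + n) (by omega)
  set r : ℝ := ψ (((k + n : ℕ):ℝ) + 1) / (((k + n : ℕ) : ℝ) + 1) ^ 2 with hr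
  have hr0 : 0 ≤ r := div_nonneg (hψ0 _) (by positivity)
  calc ∑' i : Fin (N (k + n)), ENNReal.ofReal (f (Metric.ediam (t (k + n) i)).toReal)
      ≤ ∑' i : Fin (N (k + n)), ENNReal.ofReal (f r) := by
        refine ENNReal.tsum_le_tsum fun i => ENNReal.ofReal_le_ofReal ?_
        exact hf.2.1 ENNReal.toReal_nonneg hr0 (ENNReal.toReal_le_of_le_ofReal hr0 (hd i))
    _ = ENNReal.ofReal (N (k + n) * f r) := by
        rw [ENNReal.ofReal_mul (by positivity)]
        simp
    _ ≤ ENNReal.ofReal (960 * (g r * (((k + n : ℕ) : ℝ) + 1) ^ 2)) := ENNReal.ofReal_le_ofReal hN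
    _ = 960 * F (k + n) := by
        rw [ENNReal.ofReal_mul (by norm_num)]
        simp [hF, hr]
end
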